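/- Let Γ be a cyclic group of order k ≥ 4, let 2 ≤ j ≤ k−2, and let (G,ψ) be a ℤ_k^j-gain tight Γ-gain graph with a free vertex v of degree 3 which has no loop. Let (G₁,ψ₁) and (G₂,ψ₂) be obtained from (G,ψ) by applying two different 1-reductions at v, adding the edges f₁ and f₂ respectively, and suppose that for i = 1,2 the graph (G_i,ψ_i) has a blocker H_i; set H = H₁ ∪ H₂. If E(H₁ ∩ H₂) ≠ ∅ and H₁ ∩ H₂ is balanced, then |E(H)| = 2|V(H)| − 3 + α_k^j(H + f₁ + f₂). -/

import Mathlib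

open scoped Classical

namespace GR

/-- A finite directed multigraph with edge labels ("gains") in a group `Γ` and a
designated finite set of fixed vertices. -/
structure GainedGraph (V E Γ : Type) where
  tail : E → V
  head : E → V
  gain : E → Γ
  fixed : Finset V

variable {V E Γ : Type} [DecidableEq V] [DecidableEq E] [Fintype V] [Fintype E] [Group Γ]

/-- A subgraph: a set of vertices and a set of edges whose endpoints lie in the vertex set. -/
structure Subgraph (G : GainedGraph V E Γ) where
  verts : Finset V
  edges : Finset E
  tail_mem : ∀ e ∈ edges, G.tail e ∈ verts
  head_mem : ∀ e ∈ edges, G.head e ∈ verts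

namespace Subgraph

variable {G : GainedGraph V E Γ}

instance : Top (Subgraph G) :=
  ⟨⟨Finset.univ, Finset.univ, fun _ _ => Finset.mem_univ _, fun _ _ => Finset.mem_univ _⟩⟩

instance : LE (Subgraph G) :=
  ⟨fun H K => H.verts ⊆ K.verts ∧ H.edges ⊆ K.edges⟩

def union (H K : Subgraph G) : Subgraph G where
  verts := H.verts ∪ K.verts
  edges := H.edges ∪ K.edges
  tail_mem e he := by
    rcases Finset.mem_union.1 he with h | h
    · exact Finset.mem_union_left _ (H.tail_mem e h)
    · exact Finset.mem_union_right _ (K.tail_mem e h)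
  head_mem e he := by
    rcases Finset.mem_union.1 he with h | h
    · exact Finset.mem_union_left _ (H.head_mem e h)
    · exact Finset.mem_union_right _ (K.head_mem e h)

def inter (H K : Subgraph G) : Subgraph G where
  verts := H.verts ∩ K.verts
  edges := H.edges ∩ K.edges
  tail_mem e he := by
    rcases Finset.mem_inter.1 he with ⟨h1, h2⟩
    exact Finset.mem_inter.2 ⟨H.tail_mem e h1, K.tail_mem e h2⟩
  head_mem e he := by
    rcases Finset.mem_inter.1 he with ⟨h1, h2⟩
    exact Finset.mem_inter.2 ⟨H.head_mem e h1, K.head_mem e h2⟩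

/-- Delete a vertex together with all edges incident to it. -/
def deleteVertex (H : Subgraph G) (v : V) : Subgraph G where
  verts := H.verts.erase v
  edges := H.edges.filter fun e => G.tail e ≠ v ∧ G.head e ≠ v
  tail_mem e he := by
    rcases Finset.mem_filter.1 he with ⟨h1, h2, h3⟩
    exact Finset.mem_erase.2 ⟨h2, H.tail_mem e h1⟩
  head_mem e he := by
    rcases Finset.mem_filter.1 he with ⟨h1, h2, h3⟩
    exact Finset.mem_erase.2 ⟨h3, H.head_mem e h1⟩

/-- Delete an edge. -/
def deleteEdge (H : Subgraph G) (f : E) : Subgraph G where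
  verts := H.verts
  edges := H.edges.erase f
  tail_mem e he := H.tail_mem e (Finset.mem_of_mem_erase he)
  head_mem e he := H.head_mem e (Finset.mem_of_mem_erase he)

/-- Add an edge (together with its endpoints). -/
def addEdge (H : Subgraph G) (f : E) : Subgraph G where
  verts := insert (G.tail f) (insert (G.head f) H.verts)
  edges := insert f H.edges
  tail_mem e he := by
    rcases Finset.mem_insert.1 he with rfl | h
    · exact Finset.mem_insert_self _ _
    · exact Finset.mem_insert_of_mem (Finset.mem_insert_of_mem (H.tail_mem e h))
  head_mem e he := by
    rcases Finset.mem_insert.1 he with rfl | h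
    · exact Finset.mem_insert_of_mem (Finset.mem_insert_self _ _)
    · exact Finset.mem_insert_of_mem (Finset.mem_insert_of_mem (H.head_mem e h))

/-- The free vertices of a subgraph. -/
def freeVerts (H : Subgraph G) : Finset V := H.verts \ G.fixed

/-- The fixed vertices of a subgraph. -/
def fixedVerts (H : Subgraph G) : Finset V := H.verts ∩ G.fixed

end Subgraph

/-- The starting vertex of an oriented traversal of an edge. -/
def stepStart (G : GainedGraph V E Γ) (s : E × Bool) : V :=
  if s.2 then G.tail s.1 else G.head s.1

/-- The ending vertex of an oriented traversal of an edge. -/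
def stepEnd (G : GainedGraph V E Γ) (s : E × Bool) : V :=
  if s.2 then G.head s.1 else G.tail s.1

/-- The gain contributed by an oriented traversal of an edge. -/
def stepGain (G : GainedGraph V E Γ) (s : E × Bool) : Γ :=
  if s.2 then G.gain s.1 else (G.gain s.1)⁻¹

/-- `IsWalk G H L u w` : `L` is a walk in the subgraph `H` from `u` to `w`. -/
def IsWalk (G : GainedGraph V E Γ) (H : Subgraph G) : List (E × Bool) → V → V → Prop
  | [], u, w => u = w ∧ u ∈ H.verts
  | s :: L, u, w => s.1 ∈ H.edges ∧ stepStart G s = u ∧ IsWalk G H L (stepEnd G s) w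

/-- The gain of a walk. -/
def walkGain (G : GainedGraph V E Γ) (L : List (E × Bool)) : Γ :=
  (L.map (stepGain G)).prod

/-- The vertices visited by a walk starting at `u`. -/
def walkVerts (G : GainedGraph V E Γ) (u : V) (L : List (E × Bool)) : List V :=
  u :: L.map (stepEnd G)

/-- `⟨H⟩` : the subgroup of `Γ` generated by the gains of all closed walks in `H`
containing no fixed vertex. -/
def gainGroup (G : GainedGraph V E Γ) (H : Subgraph G) : Subgroup Γ :=
  Subgroup.closure
    {g | ∃ u L, IsWalk G H L u u ∧ (∀ x ∈ walkVerts G u L, x ∉ G.fixed) ∧ walkGain G L = g}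

/-- A subgraph is balanced if its gain group is trivial. -/
def Balanced (G : GainedGraph V E Γ) (H : Subgraph G) : Prop := gainGroup G H = ⊥

def Reachable (G : GainedGraph V E Γ) (H : Subgraph G) (u w : V) : Prop :=
  ∃ L, IsWalk G H L u w

def Connected (G : GainedGraph V E Γ) (H : Subgraph G) : Prop :=
  H.verts.Nonempty ∧ ∀ u ∈ H.verts, ∀ w ∈ H.verts, Reachable G H u w

/-- `v` is a cut-vertex of the subgraph `H`. -/
def IsCutVertex (G : GainedGraph V E Γ) (H : Subgraph G) (v : V) : Prop :=
  v ∈ H.verts ∧ ∃ u ∈ H.verts, ∃ w ∈ H.verts, u ≠ v ∧ w ≠ v ∧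
    Reachable G H u w ∧ ¬ Reachable G (H.deleteVertex v) u w

/-- `(2,m,l)`-sparsity of the subgraph `K`. -/
def Sparse (G : GainedGraph V E Γ) (m l : ℤ) (K : Subgraph G) : Prop :=
  ∀ H : Subgraph G, H ≤ K → H.edges.Nonempty →
    (H.edges.card : ℤ) ≤ 2 * (H.freeVerts.card : ℤ) + m * (H.fixedVerts.card : ℤ) - l

/-- `(2,m,l)`-tightness of the subgraph `K`. -/
def Tight (G : GainedGraph V E Γ) (m l : ℤ) (K : Subgraph G) : Prop :=
  Sparse G m l K ∧
    (K.edges.card : ℤ) = 2 * (K.freeVerts.card : ℤ) + m * (K.fixedVerts.card : ℤ) - l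

/-- `(2,m,3,l)`-gain-tightness: `(2,m,l)`-tight and every balanced subgraph with a
nonempty edge set is `(2,3)`-sparse. -/
def GainTight23 (G : GainedGraph V E Γ) (m l : ℤ) (K : Subgraph G) : Prop :=
  Tight G m l K ∧ ∀ H : Subgraph G, H ≤ K → H.edges.Nonempty → Balanced G H →
    (H.edges.card : ℤ) ≤ 2 * (H.verts.card : ℤ) - 3

/-- The subgraph has no fixed vertex. -/
def NoFixed (G : GainedGraph V E Γ) (H : Subgraph G) : Prop :=
  ∀ x ∈ H.verts, x ∉ G.fixed

/-- Near-balanced with base vertex `v` and gain `δ`: unbalanced, and every closed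
walk starting at `v` not containing `v` as an internal vertex has gain `1`, `δ` or `δ⁻¹`. -/
def NearBalancedAt (G : GainedGraph V E Γ) (H : Subgraph G) (v : V) (δ : Γ) : Prop :=
  ¬ Balanced G H ∧ ∀ L, IsWalk G H L v v →
    (∀ x ∈ (L.map (stepEnd G)).dropLast, x ≠ v) → walkGain G L ∈ ({1, δ, δ⁻¹} : Set Γ)

def NearBalanced (G : GainedGraph V E Γ) (H : Subgraph G) : Prop :=
  NoFixed G H ∧ ∃ v ∈ H.verts, ∃ δ : Γ, NearBalancedAt G H v δ

/-- The gain group of `H` is isomorphic to `ℤ_n`. -/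
def IsZIso (G : GainedGraph V E Γ) (H : Subgraph G) (n : ℕ) : Prop :=
  Nonempty (gainGroup G H ≃* Multiplicative (ZMod n))

def ProperNearBalanced (G : GainedGraph V E Γ) (H : Subgraph G) : Prop :=
  NearBalanced G H ∧ ¬ IsZIso G H 2 ∧ ¬ IsZIso G H 3

/-- The set `S_i(k,j)`. -/
def SSet (k j : ℕ) (i : ℤ) : Set ℕ :=
  {n | 2 ≤ n ∧ n ∣ k ∧ (Odd j → n ≠ 2) ∧ ((j : ZMod n) = (i : ZMod n))}

/-- `H` is `S_i(k,j)`. -/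
def IsS (G : GainedGraph V E Γ) (k j : ℕ) (i : ℤ) (H : Subgraph G) : Prop :=
  ∃ n ∈ SSet k j i, IsZIso G H n

/-- `H` is `S_{±1}(k,j)`. -/
def IsSpm (G : GainedGraph V E Γ) (k j : ℕ) (H : Subgraph G) : Prop :=
  IsS G k j (-1) H ∨ IsS G k j 1 H

/-- The function `α_k^j` on (connected) subgraphs. -/
noncomputable def alpha (G : GainedGraph V E Γ) (k j : ℕ) (X : Subgraph G) : ℤ :=
  if Balanced G X then 0
  else if Odd j ∧ IsZIso G X 2 then 1
  else if IsSpm G k j X then 2 - (X.fixedVerts.card : ℤ)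
  else if IsS G k j 0 X ∨ (X.fixedVerts.card = 0 ∧ ProperNearBalanced G X) then
    2 - 2 * (X.fixedVerts.card : ℤ)
  else 3 - 2 * (X.fixedVerts.card : ℤ)

/-- The subgraph spanned by a set of edges. -/
def edgeSpan (G : GainedGraph V E Γ) (F : Finset E) : Subgraph G where
  verts := F.image G.tail ∪ F.image G.head
  edges := F
  tail_mem e he := Finset.mem_union_left _ (Finset.mem_image_of_mem _ he)
  head_mem e he := Finset.mem_union_right _ (Finset.mem_image_of_mem _ he)

/-- The connected component of the edge `e` in the subgraph spanned by `F`. -/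
noncomputable def componentOf (G : GainedGraph V E Γ) (F : Finset E) (e : E) : Subgraph G :=
  edgeSpan G (F.filter fun f => Reachable G (edgeSpan G F) (G.tail e) (G.tail f))

/-- The connected components of the edge set `F`. -/
noncomputable def components (G : GainedGraph V E Γ) (F : Finset E) : Finset (Subgraph G) :=
  F.image (componentOf G F)

/-- The count `f_k^j(F) = Σ_{X ∈ C(F)} (2|V(X)| − 3 + α_k^j(X))`. -/
noncomputable def fCount (G : GainedGraph V E Γ) (k j : ℕ) (F : Finset E) : ℤ :=
  ∑ X ∈ components G F, (2 * (X.verts.card : ℤ) - 3 + alpha G k j X)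

/-- `ℤ_k^j`-gain sparsity. -/
def GainSparseKJ (G : GainedGraph V E Γ) (k j : ℕ) (K : Subgraph G) : Prop :=
  ∀ H : Subgraph G, H ≤ K → H.edges.Nonempty → (H.edges.card : ℤ) ≤ fCount G k j H.edges

/-- `ℤ_k^j`-gain tightness. -/
def GainTightKJ (G : GainedGraph V E Γ) (k j : ℕ) (K : Subgraph G) : Prop :=
  GainSparseKJ G k j K ∧ (K.edges.card : ℤ) = fCount G k j K.edges

/-- The degree of a vertex in a subgraph (a loop counts twice). -/
def degree (G : GainedGraph V E Γ) (K : Subgraph G) (v : V) : ℕ :=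
  (K.edges.filter fun e => G.tail e = v).card + (K.edges.filter fun e => G.head e = v).card

def HasLoopAt (G : GainedGraph V E Γ) (K : Subgraph G) (v : V) : Prop :=
  ∃ e ∈ K.edges, G.tail e = v ∧ G.head e = v

/-- The neighbours of a vertex in a subgraph. -/
def neighbors (G : GainedGraph V E Γ) (K : Subgraph G) (v : V) : Finset V :=
  ((K.edges.filter fun e => G.tail e = v).image G.head) ∪
    ((K.edges.filter fun e => G.head e = v).image G.tail)

/-- The subgraph `K` satisfies the axioms of a `Γ`-gain graph. -/
structure IsGainGraphOn (G : GainedGraph V E Γ) (K : Subgraph G) : Prop where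
  fixed_card : K.fixedVerts.card ≤ 1
  same_dir : ∀ e ∈ K.edges, ∀ f ∈ K.edges, e ≠ f → G.tail e = G.tail f →
    G.head e = G.head f → G.gain e ≠ G.gain f
  opp_dir : ∀ e ∈ K.edges, ∀ f ∈ K.edges, e ≠ f → G.tail e = G.head f →
    G.head e = G.tail f → G.gain e ≠ (G.gain f)⁻¹
  fixed_not_loop : ∀ e ∈ K.edges, G.tail e = G.head e → G.tail e ∉ G.fixed
  fixed_not_parallel : ∀ e ∈ K.edges, ∀ f ∈ K.edges, e ≠ f →
    (G.tail e ∈ G.fixed ∨ G.head e ∈ G.fixed) →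
    ({G.tail e, G.head e} : Finset V) ≠ {G.tail f, G.head f}
  loop_gain : ∀ e ∈ K.edges, G.tail e = G.head e → G.gain e ≠ 1

/-- `H` together with the vertex `v` and all edges of `G₀` incident to `v`. -/
def addVertexEdges (G : GainedGraph V E Γ) (G₀ H : Subgraph G) (v : V) : Subgraph G where
  verts := (H.verts ∪ {v}) ∪
    ((G₀.edges.filter fun e => G.tail e = v ∨ G.head e = v).image G.tail ∪
      (G₀.edges.filter fun e => G.tail e = v ∨ G.head e = v).image G.head)
  edges := H.edges ∪ G₀.edges.filter fun e => G.tail e = v ∨ G.head e = v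
  tail_mem e he := by
    rcases Finset.mem_union.1 he with h | h
    · exact Finset.mem_union_left _ (Finset.mem_union_left _ (H.tail_mem e h))
    · exact Finset.mem_union_right _ (Finset.mem_union_left _ (Finset.mem_image_of_mem _ h))
  head_mem e he := by
    rcases Finset.mem_union.1 he with h | h
    · exact Finset.mem_union_left _ (Finset.mem_union_left _ (H.head_mem e h))
    · exact Finset.mem_union_right _ (Finset.mem_union_right _ (Finset.mem_image_of_mem _ h))

/-- The result of a 1-reduction at `v` adding the edge `f`: delete `v` and all edges at
`v` and add the edge `f`. -/
def reduceAt (G : GainedGraph V E Γ) (G₀ : Subgraph G) (v : V) (f : E) : Subgraph G where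
  verts := insert (G.tail f) (insert (G.head f) (G₀.verts.erase v))
  edges := insert f (G₀.edges.filter fun e => G.tail e ≠ v ∧ G.head e ≠ v)
  tail_mem e he := by
    rcases Finset.mem_insert.1 he with rfl | h
    · exact Finset.mem_insert_self _ _
    · rcases Finset.mem_filter.1 h with ⟨h1, h2, h3⟩
      exact Finset.mem_insert_of_mem
        (Finset.mem_insert_of_mem (Finset.mem_erase.2 ⟨h2, G₀.tail_mem e h1⟩))
  head_mem e he := by
    rcases Finset.mem_insert.1 he with rfl | h
    · exact Finset.mem_insert_of_mem (Finset.mem_insert_self _ _)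
    · rcases Finset.mem_filter.1 h with ⟨h1, h2, h3⟩
      exact Finset.mem_insert_of_mem
        (Finset.mem_insert_of_mem (Finset.mem_erase.2 ⟨h3, G₀.head_mem e h1⟩))

/-- The new edge `f` arises from a 1-reduction at the vertex `v` of `G₀`: its endpoints are
joined to `v` by two distinct edges of `G₀` and its gain is the gain of the corresponding
path of length two through `v`. -/
def IsOneReduction (G : GainedGraph V E Γ) (G₀ : Subgraph G) (v : V) (f : E) : Prop :=
  f ∉ G₀.edges ∧ G.tail f ≠ v ∧ G.head f ≠ v ∧
    ∃ s₁ s₂ : E × Bool, s₁.1 ∈ G₀.edges ∧ s₂.1 ∈ G₀.edges ∧ s₁.1 ≠ s₂.1 ∧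
      stepEnd G s₁ = v ∧ stepStart G s₂ = v ∧
      G.tail f = stepStart G s₁ ∧ G.head f = stepEnd G s₂ ∧
      G.gain f = stepGain G s₁ * stepGain G s₂

/-- Two labelled edges coincide (up to reorientation with gain inversion). -/
def SameEdge (G : GainedGraph V E Γ) (e f : E) : Prop :=
  (G.tail e = G.tail f ∧ G.head e = G.head f ∧ G.gain e = G.gain f) ∨
    (G.tail e = G.head f ∧ G.head e = G.tail f ∧ G.gain e = (G.gain f)⁻¹)

/-- `H` is a blocker of the 1-reduction at `v` adding the edge `f`. -/
def IsBlocker (G : GainedGraph V E Γ) (k j : ℕ) (G₀ : Subgraph G) (v : V) (f : E)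
    (H : Subgraph G) : Prop :=
  H ≤ G₀ ∧ v ∉ H.verts ∧ G.tail f ∈ H.verts ∧ G.head f ∈ H.verts ∧ H.edges.Nonempty ∧
    Connected G (H.addEdge f) ∧
    (H.edges.card : ℤ) = 2 * (H.verts.card : ℤ) - 3 + alpha G k j (H.addEdge f)

/-- The graph `G` extended by one fresh edge `none` with tail `t`, head `h` and gain `g`. -/
def extendGraph (G : GainedGraph V E Γ) (t h : V) (g : Γ) : GainedGraph V (Option E) Γ where
  tail e := e.elim t G.tail
  head e := e.elim h G.head
  gain e := e.elim g G.gain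
  fixed := G.fixed

/-- The whole original graph `G`, viewed inside the extension. -/
def extendTop (G : GainedGraph V E Γ) (t h : V) (g : Γ) : Subgraph (extendGraph G t h g) where
  verts := Finset.univ
  edges := Finset.univ.image Option.some
  tail_mem _ _ := Finset.mem_univ _
  head_mem _ _ := Finset.mem_univ _

/-- There is an admissible 1-reduction at `v`, i.e. a choice of new edge (with
endpoints and gain coming from a path of length two through `v`) such that the
resulting `Γ`-gain graph is well defined and `ℤ_k^j`-gain tight. -/
def AdmissibleOneReductionExists (G : GainedGraph V E Γ) (k j : ℕ) (v : V) : Prop :=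
  ∃ t h : V, ∃ g : Γ,
    IsOneReduction (extendGraph G t h g) (extendTop G t h g) v none ∧
    IsGainGraphOn (extendGraph G t h g)
      (reduceAt (extendGraph G t h g) (extendTop G t h g) v none) ∧
    GainTightKJ (extendGraph G t h g) k j
      (reduceAt (extendGraph G t h g) (extendTop G t h g) v none)

end GR

namespace GR

section Walks

variable {V E Γ : Type} {G : GainedGraph V E Γ}

theorem stepStart_mem {K : Subgraph G} {s : E × Bool} (h : s.1 ∈ K.edges) :
    stepStart G s ∈ K.verts := by
  unfold stepStart
  split_ifs
  · exact K.tail_mem _ h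
  · exact K.head_mem _ h

theorem stepEnd_mem {K : Subgraph G} {s : E × Bool} (h : s.1 ∈ K.edges) :
    stepEnd G s ∈ K.verts := by
  unfold stepEnd
  split_ifs
  · exact K.head_mem _ h
  · exact K.tail_mem _ h

/-- The traversal of the same edge in the opposite direction. -/
def stepRev (s : E × Bool) : E × Bool := (s.1, !s.2)

theorem stepStart_rev (s : E × Bool) : stepStart G (stepRev s) = stepEnd G s := by
  rcases s with ⟨e, _ | _⟩ <;> rfl

theorem stepEnd_rev (s : E × Bool) : stepEnd G (stepRev s) = stepStart G s := by
  rcases s with ⟨e, _ | _⟩ <;> rfl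

theorem IsWalk.start_mem {K : Subgraph G} {L : List (E × Bool)} {u w : V}
    (h : IsWalk G K L u w) : u ∈ K.verts := by
  cases L with
  | nil => exact h.2
  | cons s L => exact h.2.1 ▸ stepStart_mem h.1

theorem IsWalk.append {K : Subgraph G} {L₁ L₂ : List (E × Bool)} {u x w : V}
    (h₁ : IsWalk G K L₁ u x) (h₂ : IsWalk G K L₂ x w) : IsWalk G K (L₁ ++ L₂) u w := by
  induction L₁ generalizing u with
  | nil => exact h₁.1 ▸ h₂
  | cons s L ih => exact ⟨h₁.1, h₁.2.1, ih h₁.2.2⟩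

theorem isWalk_singleton {K : Subgraph G} {s : E × Bool} (h : s.1 ∈ K.edges) :
    IsWalk G K [s] (stepStart G s) (stepEnd G s) :=
  ⟨h, rfl, rfl, stepEnd_mem h⟩

theorem isWalk_concat {K : Subgraph G} {L : List (E × Bool)} {s : E × Bool} {u w : V} :
    IsWalk G K (L ++ [s]) u w ↔
      IsWalk G K L u (stepStart G s) ∧ s.1 ∈ K.edges ∧ stepEnd G s = w := by
  induction L generalizing u with
  | nil =>
    constructor
    · rintro ⟨h1, h2, h3, -⟩
      exact ⟨⟨h2.symm, h2 ▸ stepStart_mem h1⟩, h1, h3⟩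
    · rintro ⟨⟨h1, -⟩, h2, h3⟩
      exact ⟨h2, h1.symm, h3, stepEnd_mem h2⟩
  | cons t L ih =>
    simp only [List.cons_append, IsWalk, ih]
    tauto

theorem Reachable.trans {K : Subgraph G} {u x w : V} (h₁ : Reachable G K u x)
    (h₂ : Reachable G K x w) : Reachable G K u w := by
  obtain ⟨L₁, h₁⟩ := h₁
  obtain ⟨L₂, h₂⟩ := h₂
  exact ⟨_, h₁.append h₂⟩

theorem reachable_refl {K : Subgraph G} {u : V} (h : u ∈ K.verts) : Reachable G K u u :=
  ⟨[], rfl, h⟩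

theorem reachable_step {K : Subgraph G} {s : E × Bool} (h : s.1 ∈ K.edges) :
    Reachable G K (stepStart G s) (stepEnd G s) :=
  ⟨[s], isWalk_singleton h⟩

theorem reachable_edge {K : Subgraph G} {e : E} (h : e ∈ K.edges) :
    Reachable G K (G.tail e) (G.head e) :=
  reachable_step (s := (e, true)) h

theorem IsWalk.preserves {K : Subgraph G} {P : V → Prop}
    (hP : ∀ e ∈ K.edges, (P (G.tail e) ↔ P (G.head e))) {L : List (E × Bool)} {u w : V}
    (h : IsWalk G K L u w) (hu : P u) : P w := by
  induction L generalizing u with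
  | nil => exact h.1 ▸ hu
  | cons s L ih =>
    obtain ⟨h1, rfl, h2⟩ := h
    refine ih h2 ?_
    rcases s with ⟨e, _ | _⟩
    · exact (hP e h1).2 hu
    · exact (hP e h1).1 hu

theorem IsWalk.mono {K K' : Subgraph G} (h : K ≤ K') {L : List (E × Bool)} {u w : V}
    (hL : IsWalk G K L u w) : IsWalk G K' L u w := by
  induction L generalizing u with
  | nil => exact ⟨hL.1, h.1 hL.2⟩
  | cons s L ih => exact ⟨h.2 hL.1, hL.2.1, ih hL.2.2⟩

theorem subgraph_le_trans {K₁ K₂ K₃ : Subgraph G} (h : K₁ ≤ K₂) (h' : K₂ ≤ K₃) : K₁ ≤ K₃ :=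
  ⟨h.1.trans h'.1, h.2.trans h'.2⟩

variable [CommGroup Γ]

theorem stepGain_rev (s : E × Bool) : stepGain G (stepRev s) = (stepGain G s)⁻¹ := by
  rcases s with ⟨e, _ | _⟩ <;> simp [stepGain, stepRev]

theorem walkGain_append (L₁ L₂ : List (E × Bool)) :
    walkGain G (L₁ ++ L₂) = walkGain G L₁ * walkGain G L₂ := by
  simp [walkGain]

theorem walkGain_singleton (s : E × Bool) : walkGain G [s] = stepGain G s := by
  simp [walkGain]

theorem IsWalk.exists_reverse {K : Subgraph G} {L : List (E × Bool)} {u w : V}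
    (h : IsWalk G K L u w) : ∃ L', IsWalk G K L' w u ∧ walkGain G L' = (walkGain G L)⁻¹ ∧
      ∀ x ∈ walkVerts G w L', x ∈ walkVerts G u L := by
  induction L generalizing u with
  | nil =>
    obtain ⟨rfl, h⟩ := h
    exact ⟨[], ⟨rfl, h⟩, by simp [walkGain], by simp⟩
  | cons s L ih =>
    obtain ⟨h1, rfl, h2⟩ := h
    obtain ⟨L', a, b, c⟩ := ih h2
    refine ⟨L' ++ [stepRev s], ?_, ?_, ?_⟩
    · rw [isWalk_concat, stepStart_rev, stepEnd_rev]
      exact ⟨a, h1, rfl⟩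
    · rw [walkGain_append, b, walkGain_singleton, stepGain_rev]
      simp [walkGain, mul_comm]
    · intro x hx
      simp only [walkVerts, List.map_append, List.mem_cons, List.mem_append, List.map_cons,
        List.map_nil, List.not_mem_nil, or_false, stepEnd_rev] at hx c ⊢
      rcases hx with hx | hx | hx
      · exact Or.inr (c x (Or.inl hx))
      · exact Or.inr (c x (Or.inr hx))
      · exact Or.inl hx

theorem Reachable.symm {K : Subgraph G} {u w : V} (h : Reachable G K u w) :
    Reachable G K w u := by
  obtain ⟨L, hL⟩ := h
  obtain ⟨L', hL', -⟩ := hL.exists_reverse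
  exact ⟨L', hL'⟩

theorem Reachable.transport {K K' : Subgraph G}
    (hK : ∀ e ∈ K.edges, Reachable G K' (G.tail e) (G.head e)) {u w : V}
    (h : Reachable G K u w) (hu : u ∈ K'.verts) : Reachable G K' u w := by
  obtain ⟨L, hL⟩ := h
  exact hL.preserves (P := fun x => Reachable G K' u x)
    (fun e he => ⟨fun h => h.trans (hK e he), fun h => h.trans (hK e he).symm⟩)
    (reachable_refl hu)

theorem gainGroup_mono {K K' : Subgraph G} (h : K ≤ K') : gainGroup G K ≤ gainGroup G K' := by
  apply Subgroup.closure_mono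
  rintro g ⟨u, L, h1, h2, h3⟩
  exact ⟨u, L, h1.mono h, h2, h3⟩

theorem Balanced.mono {K K' : Subgraph G} (h : K ≤ K') (hb : Balanced G K') : Balanced G K :=
  le_bot_iff.1 ((gainGroup_mono h).trans hb.le)

/-- `p` is a potential for the gains on the free part of `K`, modulo `N`. -/
def IsPotential (G : GainedGraph V E Γ) (K : Subgraph G) (N : Subgroup Γ) (p : V → Γ) : Prop :=
  ∀ e ∈ K.edges, G.tail e ∉ G.fixed → G.head e ∉ G.fixed →
    p (G.tail e) * G.gain e * (p (G.head e))⁻¹ ∈ N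

theorem IsPotential.step {K : Subgraph G} {N : Subgroup Γ} {p : V → Γ} (hp : IsPotential G K N p)
    {s : E × Bool} (hs : s.1 ∈ K.edges) (h1 : stepStart G s ∉ G.fixed)
    (h2 : stepEnd G s ∉ G.fixed) :
    p (stepStart G s) * stepGain G s * (p (stepEnd G s))⁻¹ ∈ N := by
  rcases s with ⟨e, _ | _⟩
  · have := N.inv_mem (hp e hs h2 h1)
    simp only [stepStart, stepEnd, stepGain, Bool.false_eq_true, if_false]
    convert this using 1
    simp only [mul_inv, inv_inv]
    simp only [mul_comm, mul_left_comm]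
  · exact hp e hs h1 h2

theorem IsPotential.walk {K : Subgraph G} {N : Subgroup Γ} {p : V → Γ} (hp : IsPotential G K N p)
    {L : List (E × Bool)} {u w : V} (hL : IsWalk G K L u w)
    (hf : ∀ x ∈ walkVerts G u L, x ∉ G.fixed) : p u * walkGain G L * (p w)⁻¹ ∈ N := by
  induction L generalizing u with
  | nil =>
    obtain ⟨rfl, -⟩ := hL
    simp [walkGain]
  | cons s L ih =>
    obtain ⟨h1, rfl, h2⟩ := hL
    have h3 : ∀ x ∈ walkVerts G (stepEnd G s) L, x ∉ G.fixed := fun x hx =>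
      hf x (List.mem_cons_of_mem _ hx)
    have h4 := hp.step h1 (hf _ List.mem_cons_self) (h3 _ List.mem_cons_self)
    convert N.mul_mem h4 (ih h2 h3) using 1
    simp only [walkGain, List.map_cons, List.prod_cons]
    group

theorem IsPotential.gainGroup_le {K : Subgraph G} {N : Subgroup Γ} {p : V → Γ}
    (hp : IsPotential G K N p) : gainGroup G K ≤ N := by
  refine (Subgroup.closure_le N).2 ?_
  rintro g ⟨u, L, h1, h2, rfl⟩
  have := hp.walk h1 h2
  rwa [mul_comm (p u), mul_inv_cancel_right] at this

theorem exists_isPotential (K : Subgraph G) {N : Subgroup Γ} (hN : gainGroup G K ≤ N) :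
    ∃ p, IsPotential G K N p := by
  let R : V → V → Γ → Prop := fun u w g =>
    ∃ L, IsWalk G K L u w ∧ (∀ x ∈ walkVerts G u L, x ∉ G.fixed) ∧ walkGain G L = g
  have hsymm : ∀ {u w g}, R u w g → R w u g⁻¹ := by
    rintro u w g ⟨L, h1, h2, rfl⟩
    obtain ⟨L', a, b, c⟩ := h1.exists_reverse
    exact ⟨L', a, fun x hx => h2 x (c x hx), b⟩
  have htrans : ∀ {u x w g h}, R u x g → R x w h → R u w (g * h) := by
    rintro u x w g h ⟨L, h1, h2, rfl⟩ ⟨L', h1', h2', rfl⟩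
    refine ⟨L ++ L', h1.append h1', ?_, walkGain_append _ _⟩
    intro y hy
    simp only [walkVerts, List.map_append, List.mem_cons, List.mem_append] at hy h2 h2'
    rcases hy with hy | hy | hy
    · exact h2 y (Or.inl hy)
    · exact h2 y (Or.inr hy)
    · exact h2' y (Or.inr hy)
  let S : Setoid V := ⟨fun u w => u = w ∨ ∃ g, R u w g, fun _ => Or.inl rfl,
    by
      rintro u w (rfl | ⟨g, h⟩)
      · exact Or.inl rfl
      · exact Or.inr ⟨_, hsymm h⟩,
    by
      rintro u x w (rfl | ⟨g, h⟩) (rfl | ⟨g', h'⟩)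
      · exact Or.inl rfl
      · exact Or.inr ⟨_, h'⟩
      · exact Or.inr ⟨_, h⟩
      · exact Or.inr ⟨_, htrans h h'⟩⟩
  let r : V → V := fun u => (Quotient.mk S u).out
  let p : V → Γ := fun u => if h : ∃ g, R (r u) u g then h.choose else 1
  refine ⟨p, fun e he ht hh => ?_⟩
  have hR : R (G.tail e) (G.head e) (G.gain e) := by
    refine ⟨[(e, true)], isWalk_singleton (s := (e, true)) he, ?_, walkGain_singleton _⟩
    simp only [walkVerts, List.map_cons, List.map_nil, List.mem_cons, List.not_mem_nil, or_false]
    rintro x (rfl | rfl)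
    · exact ht
    · exact hh
  have hp : ∀ {u}, (∃ w g, R u w g) → R (r u) u (p u) := by
    rintro u ⟨w, g, h⟩
    have : ∃ g, R (r u) u g := by
      rcases (Quotient.mk_out (s := S) u : r u = u ∨ ∃ g, R (r u) u g) with h1 | h1
      · have h2 : r u = u := h1
        rw [h2]
        exact ⟨_, htrans h (hsymm h)⟩
      · exact h1
    simp only [p, dif_pos this]
    exact this.choose_spec
  have hr : r (G.tail e) = r (G.head e) := by
    have : Quotient.mk S (G.tail e) = Quotient.mk S (G.head e) :=
      Quotient.sound (Or.inr ⟨_, hR⟩)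
    simp only [r, this]
  have h1 := hp ⟨_, _, hR⟩
  have h2 := hp ⟨_, _, hsymm hR⟩
  rw [← hr] at h2
  obtain ⟨L, a, b, c⟩ := htrans (htrans h1 hR) (hsymm h2)
  exact hN (Subgroup.subset_closure ⟨_, L, a, b, c⟩)

theorem IsPotential.mono {K K' : Subgraph G} {N : Subgroup Γ} {p : V → Γ} (h : K ≤ K')
    (hp : IsPotential G K' N p) : IsPotential G K N p :=
  fun e he => hp e (h.2 he)

theorem IsPotential.ratio {K : Subgraph G} {N : Subgroup Γ} {p q : V → Γ}
    (hK : Connected G K) (hf : NoFixed G K) (hp : IsPotential G K N p) (hq : IsPotential G K N q)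
    {x y : V} (hx : x ∈ K.verts) (hy : y ∈ K.verts) :
    p x * (q x)⁻¹ * (p y)⁻¹ * q y ∈ N := by
  obtain ⟨L, hL⟩ := hK.2 x hx y hy
  have hfree : ∀ {L : List (E × Bool)} {u w : V}, IsWalk G K L u w →
      ∀ z ∈ walkVerts G u L, z ∉ G.fixed := by
    intro L
    induction L with
    | nil =>
      intro u w h z hz
      simp only [walkVerts, List.map_nil, List.mem_cons, List.not_mem_nil, or_false] at hz
      exact hz ▸ hf u h.2
    | cons s L ih =>
      intro u w h z hz
      rcases List.mem_cons.1 hz with rfl | hz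
      · exact hf _ h.start_mem
      · exact ih h.2.2 z hz
  have h1 := hp.walk hL (hfree hL)
  have h2 := hq.walk hL (hfree hL)
  convert N.mul_mem h1 (N.inv_mem h2) using 1
  simp only [mul_inv, inv_inv]
  have : (p x * walkGain G L * (p y)⁻¹) * ((q x)⁻¹ * (walkGain G L)⁻¹ * q y) =
    (p x * (q x)⁻¹ * (p y)⁻¹ * q y) * (walkGain G L * (walkGain G L)⁻¹) := by
    simp only [mul_comm, mul_left_comm, mul_assoc]
  rw [this, mul_inv_cancel, mul_one]

/-- Two subgraphs with gains in `N` whose intersection has connected free part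
have a union with gains in `N`. -/
theorem gainGroup_union_le [DecidableEq E] {M₁ M₂ Y K : Subgraph G} {N : Subgroup Γ}
    (hY : Y.edges ⊆ M₁.edges ∪ M₂.edges) (hK : Connected G K) (hf : NoFixed G K)
    (hK₁ : K ≤ M₁) (hK₂ : K ≤ M₂)
    (hV : ∀ x ∈ M₁.verts, x ∈ M₂.verts → x ∉ G.fixed → x ∈ K.verts)
    (h₁ : gainGroup G M₁ ≤ N) (h₂ : gainGroup G M₂ ≤ N) : gainGroup G Y ≤ N := by
  obtain ⟨p₁, hp₁⟩ := exists_isPotential M₁ h₁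
  obtain ⟨p₂, hp₂⟩ := exists_isPotential M₂ h₂
  obtain ⟨x₀, hx₀⟩ := hK.1
  set c := p₁ x₀ * (p₂ x₀)⁻¹ with hc
  let q : V → Γ := fun z => if z ∈ M₁.verts then p₁ z else c * p₂ z
  have hq₂ : ∀ z ∈ M₂.verts, z ∉ G.fixed → (c * p₂ z) * (q z)⁻¹ ∈ N := by
    intro z hz hzf
    by_cases h : z ∈ M₁.verts
    · have := (hp₁.mono hK₁).ratio hK hf (hp₂.mono hK₂) hx₀ (hV z h hz hzf)
      simp only [q, if_pos h]
      convert this using 1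
      rw [← hc, mul_right_comm]
    · simp [q, if_neg h]
  have : IsPotential G Y N q := by
    intro e he ht hh
    rcases Finset.mem_union.1 (hY he) with h | h
    · simpa only [q, if_pos (M₁.tail_mem e h), if_pos (M₁.head_mem e h)] using hp₁ e h ht hh
    · have a := hq₂ _ (M₂.tail_mem e h) ht
      have b := hq₂ _ (M₂.head_mem e h) hh
      convert N.mul_mem (N.mul_mem (N.inv_mem a) (hp₂ e h ht hh)) b using 1
      generalize q (G.tail e) = A, q (G.head e) = B, p₂ (G.tail e) = C, p₂ (G.head e) = D
      have : (c * C * A⁻¹)⁻¹ * (C * G.gain e * D⁻¹) * (c * D * B⁻¹) =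
          A * G.gain e * B⁻¹ * (c⁻¹ * c) * (C⁻¹ * C) * (D⁻¹ * D) := by
        simp only [mul_inv, inv_inv]
        simp only [mul_comm, mul_left_comm, mul_assoc]
      rw [this]
      simp
  exact this.gainGroup_le

end Walks

section Counting

variable {V E Γ : Type} [DecidableEq V] {G : GainedGraph V E Γ}

/-- The subgraph of `K` induced on the vertices in `A`. -/
def inducedOn (K : Subgraph G) (A : Finset V) : Subgraph G where
  verts := K.verts ∩ A
  edges := K.edges.filter fun e => G.tail e ∈ A ∧ G.head e ∈ A
  tail_mem e he := by
    rw [Finset.mem_filter] at he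
    exact Finset.mem_inter.2 ⟨K.tail_mem e he.1, he.2.1⟩
  head_mem e he := by
    rw [Finset.mem_filter] at he
    exact Finset.mem_inter.2 ⟨K.head_mem e he.1, he.2.2⟩

theorem inducedOn_le (K : Subgraph G) (A : Finset V) : inducedOn K A ≤ K :=
  ⟨Finset.inter_subset_left, Finset.filter_subset _ _⟩

theorem deleteVertex_le (K : Subgraph G) (w : V) : K.deleteVertex w ≤ K :=
  ⟨Finset.erase_subset _ _, Finset.filter_subset _ _⟩

theorem card_edges_le_of_separation {K : Subgraph G} {A B : Finset V}
    (h : ∀ e ∈ K.edges, (G.tail e ∈ A ∧ G.head e ∈ A) ∨ (G.tail e ∈ B ∧ G.head e ∈ B)) :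
    K.edges.card ≤ (inducedOn K A).edges.card + (inducedOn K B).edges.card := by
  refine (Finset.card_le_card ?_).trans (Finset.card_union_le _ _)
  intro e he
  simp only [inducedOn, Finset.mem_union, Finset.mem_filter, he, true_and]
  exact h e he

theorem edgeSpan_le (K : Subgraph G) : edgeSpan G K.edges ≤ K := by
  refine ⟨fun x hx => ?_, fun _ h => h⟩
  rcases Finset.mem_union.1 hx with h | h
  · obtain ⟨e, he, rfl⟩ := Finset.mem_image.1 h
    exact K.tail_mem e he
  · obtain ⟨e, he, rfl⟩ := Finset.mem_image.1 h
    exact K.head_mem e he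

variable [CommGroup Γ]

theorem exists_separation {K : Subgraph G} (hne : K.verts.Nonempty) (hK : ¬ Connected G K) :
    ∃ A B : Finset V, A.Nonempty ∧ B.Nonempty ∧ Disjoint A B ∧ A ∪ B = K.verts ∧
      ∀ e ∈ K.edges, (G.tail e ∈ A ∧ G.head e ∈ A) ∨ (G.tail e ∈ B ∧ G.head e ∈ B) := by
  have : ∃ u ∈ K.verts, ∃ w ∈ K.verts, ¬ Reachable G K u w := by
    by_contra! h
    exact hK ⟨hne, h⟩
  obtain ⟨u, hu, w, hw, huw⟩ := this
  refine ⟨K.verts.filter fun x => Reachable G K u x, K.verts.filter fun x => ¬ Reachable G K u x,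
    ⟨u, Finset.mem_filter.2 ⟨hu, reachable_refl hu⟩⟩, ⟨w, Finset.mem_filter.2 ⟨hw, huw⟩⟩,
    Finset.disjoint_filter_filter_not _ _ _, Finset.filter_union_filter_not_eq _ _, ?_⟩
  intro e he
  have h1 := K.tail_mem e he
  have h2 := K.head_mem e he
  have h3 := reachable_edge he
  simp only [Finset.mem_filter, h1, h2, true_and]
  by_cases h : Reachable G K u (G.tail e)
  · exact Or.inl ⟨h, h.trans h3⟩
  · exact Or.inr ⟨h, fun h' => h (h'.trans h3.symm)⟩

theorem connected_edgeSpan {K : Subgraph G} (hK : Connected G K) (hne : K.edges.Nonempty) :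
    Connected G (edgeSpan G K.edges) := by
  have hsub := (edgeSpan_le K).1
  refine ⟨?_, fun u hu w hw => ?_⟩
  · obtain ⟨e, he⟩ := hne
    exact ⟨_, (edgeSpan G K.edges).tail_mem e he⟩
  · exact Reachable.transport (K := K)
      (fun e he => reachable_edge (K := edgeSpan G K.edges) he)
      (hK.2 u (hsub hu) w (hsub hw)) hu

theorem fCount_of_connected {k j : ℕ} {F : Finset E} (hne : F.Nonempty)
    (hF : Connected G (edgeSpan G F)) :
    fCount G k j F =
      2 * ((edgeSpan G F).verts.card : ℤ) - 3 + alpha G k j (edgeSpan G F) := by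
  have h : ∀ e ∈ F, componentOf G F e = edgeSpan G F := by
    intro e he
    unfold componentOf
    congr 1
    refine Finset.filter_true_of_mem fun f hf => ?_
    exact hF.2 _ ((edgeSpan G F).tail_mem e he) _ ((edgeSpan G F).tail_mem f hf)
  have h2 : components G F = {edgeSpan G F} := by
    ext X
    simp only [components, Finset.mem_image, Finset.mem_singleton]
    constructor
    · rintro ⟨e, he, rfl⟩
      exact h e he
    · rintro rfl
      obtain ⟨e, he⟩ := hne
      exact ⟨e, he, h e he⟩
  rw [fCount, h2, Finset.sum_singleton]

theorem balanced_card_edges_le {k j : ℕ} {G₀ : Subgraph G} (hs : GainSparseKJ G k j G₀)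
    {K : Subgraph G} (hK : K ≤ G₀) (hb : Balanced G K) (hne : K.edges.Nonempty) :
    (K.edges.card : ℤ) ≤ 2 * (K.verts.card : ℤ) - 3 := by
  induction hn : K.verts.card using Nat.strong_induction_on generalizing K with
  | _ n ih =>
  subst hn
  by_cases hc : Connected G K
  · have h1 := hs K hK hne
    rw [fCount_of_connected hne (connected_edgeSpan hc hne)] at h1
    have h2 : alpha G k j (edgeSpan G K.edges) = 0 := if_pos (hb.mono (edgeSpan_le K))
    have h3 := Finset.card_le_card (edgeSpan_le K).1
    omega
  · obtain ⟨e₀, he₀⟩ := hne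
    obtain ⟨A, B, hA, hB, hAB, hU, hE⟩ := exists_separation ⟨_, K.tail_mem e₀ he₀⟩ hc
    have hcard : A.card + B.card = K.verts.card := by
      rw [← hU, Finset.card_union_of_disjoint hAB]
    have hAv : (inducedOn K A).verts = A :=
      Finset.inter_eq_right.2 (hU ▸ Finset.subset_union_left)
    have hBv : (inducedOn K B).verts = B :=
      Finset.inter_eq_right.2 (hU ▸ Finset.subset_union_right)
    have hA' := hA.card_pos
    have hB' := hB.card_pos
    have h1 := card_edges_le_of_separation hE
    have key : ∀ C : Finset V, (inducedOn K C).verts = C → C.card < K.verts.card →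
        (inducedOn K C).edges.Nonempty →
        ((inducedOn K C).edges.card : ℤ) ≤ 2 * (C.card : ℤ) - 3 := by
      intro C hC hlt hCne
      have := ih _ (by rw [hC]; exact hlt) (subgraph_le_trans (inducedOn_le K C) hK)
        (hb.mono (inducedOn_le K C)) hCne rfl
      rwa [hC] at this
    have hKpos : 0 < K.edges.card := Finset.card_pos.2 ⟨e₀, he₀⟩
    have kA := key A hAv (by omega)
    have kB := key B hBv (by omega)
    rw [← Finset.card_pos] at kA kB
    omega

theorem balanced_card_edges_le_of_separation {k j : ℕ} {G₀ : Subgraph G}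
    (hs : GainSparseKJ G k j G₀) {K : Subgraph G} (hK : K ≤ G₀) (hb : Balanced G K)
    (A : Finset V) :
    (inducedOn K A).edges.card = 0 ∨
      ((inducedOn K A).edges.card : ℤ) ≤ 2 * (A.card : ℤ) - 3 := by
  rcases (inducedOn K A).edges.eq_empty_or_nonempty with h | h
  · exact Or.inl (Finset.card_eq_zero.2 h)
  · have h1 := balanced_card_edges_le hs (subgraph_le_trans (inducedOn_le K A) hK)
      (hb.mono (inducedOn_le K A)) h
    have h2 : (inducedOn K A).verts.card ≤ A.card := Finset.card_le_card Finset.inter_subset_right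
    exact Or.inr (by omega)

theorem balanced_not_connected_card_le {k j : ℕ} {G₀ : Subgraph G} (hs : GainSparseKJ G k j G₀)
    {K : Subgraph G} (hK : K ≤ G₀) (hb : Balanced G K) (hne : K.edges.Nonempty)
    (hc : ¬ Connected G K) : (K.edges.card : ℤ) ≤ 2 * (K.verts.card : ℤ) - 5 := by
  obtain ⟨e₀, he₀⟩ := hne
  obtain ⟨A, B, hA, hB, hAB, hU, hE⟩ := exists_separation ⟨_, K.tail_mem e₀ he₀⟩ hc
  have hcard : A.card + B.card = K.verts.card := by
    rw [← hU, Finset.card_union_of_disjoint hAB]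
  have hA' := hA.card_pos
  have hB' := hB.card_pos
  have h1 := card_edges_le_of_separation hE
  have hKpos : 0 < K.edges.card := Finset.card_pos.2 ⟨e₀, he₀⟩
  rcases balanced_card_edges_le_of_separation hs hK hb A with h | h <;>
  rcases balanced_card_edges_le_of_separation hs hK hb B with h' | h' <;> omega

/-- A disconnected balanced subgraph with as many edges as possible
is connected up to one isolated vertex. -/
theorem exists_connected_deleteVertex {k j : ℕ} {G₀ : Subgraph G} (hs : GainSparseKJ G k j G₀)
    {K : Subgraph G} (hK : K ≤ G₀) (hb : Balanced G K) (hne : K.edges.Nonempty)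
    (hc : ¬ Connected G K) (ht : (K.edges.card : ℤ) = 2 * (K.verts.card : ℤ) - 5) :
    ∃ w ∈ K.verts, Connected G (K.deleteVertex w) := by
  obtain ⟨e₀, he₀⟩ := hne
  obtain ⟨A, B, hA, hB, hAB, hU, hE⟩ := exists_separation ⟨_, K.tail_mem e₀ he₀⟩ hc
  have hcard : A.card + B.card = K.verts.card := by
    rw [← hU, Finset.card_union_of_disjoint hAB]
  have hA' := hA.card_pos
  have hB' := hB.card_pos
  have h1 := card_edges_le_of_separation hE
  have hKpos : 0 < K.edges.card := Finset.card_pos.2 ⟨e₀, he₀⟩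
  have key : ∀ C D : Finset V, (inducedOn K C).edges.card = 0 → C.card = 1 → C ⊆ K.verts →
      (∀ e ∈ K.edges, (G.tail e ∈ C ∧ G.head e ∈ C) ∨ (G.tail e ∈ D ∧ G.head e ∈ D)) →
      Disjoint C D → ∃ w ∈ K.verts, Connected G (K.deleteVertex w) := by
    intro C D hC hC1 hCK hCD hdis
    obtain ⟨w, rfl⟩ := Finset.card_eq_one.1 hC1
    have hw : w ∈ K.verts := hCK (Finset.mem_singleton_self w)
    have hwD : w ∉ D := Finset.disjoint_singleton_left.1 hdis
    have hE' : (K.deleteVertex w).edges = K.edges := by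
      refine Finset.filter_true_of_mem fun e he => ?_
      rcases hCD e he with h | h
      · have : e ∈ (inducedOn K {w}).edges := Finset.mem_filter.2 ⟨he, h⟩
        have := Finset.card_pos.2 ⟨e, this⟩
        omega
      · exact ⟨fun h' => hwD (h' ▸ h.1), fun h' => hwD (h' ▸ h.2)⟩
    refine ⟨w, hw, ?_⟩
    by_contra hcon
    have := balanced_not_connected_card_le hs (subgraph_le_trans (deleteVertex_le K w) hK)
      (hb.mono (deleteVertex_le K w)) (hE' ▸ ⟨e₀, he₀⟩) hcon
    rw [hE'] at this
    have h2 : (K.deleteVertex w).verts.card = K.verts.card - 1 := Finset.card_erase_of_mem hw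
    have h3 := Finset.card_pos.2 ⟨w, hw⟩
    omega
  rcases balanced_card_edges_le_of_separation hs hK hb A with h | h <;>
  rcases balanced_card_edges_le_of_separation hs hK hb B with h' | h'
  · omega
  · exact key A B h (by omega) (hU ▸ Finset.subset_union_left) hE hAB
  · exact key B A h' (by omega) (hU ▸ Finset.subset_union_right) (fun e he => (hE e he).symm)
      hAB.symm
  · omega

/-- A balanced subgraph with `2|V| - 3` edges has no cut-vertex. -/
theorem connected_deleteVertex_of_tight {k j : ℕ} {G₀ : Subgraph G} (hs : GainSparseKJ G k j G₀)
    {K : Subgraph G} (hK : K ≤ G₀) (hb : Balanced G K) (hne : K.edges.Nonempty)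
    (ht : (K.edges.card : ℤ) = 2 * (K.verts.card : ℤ) - 3) {w : V} (hw : w ∈ K.verts)
    (hwne : (K.deleteVertex w).verts.Nonempty) : Connected G (K.deleteVertex w) := by
  by_contra hc
  obtain ⟨A, B, hA, hB, hAB, hU, hE⟩ := exists_separation hwne hc
  have hcard : A.card + B.card = K.verts.card - 1 := by
    rw [← Finset.card_union_of_disjoint hAB, hU]
    exact Finset.card_erase_of_mem hw
  have hA' := hA.card_pos
  have hB' := hB.card_pos
  have hKpos := Finset.card_pos.2 hne
  have hK1 := Finset.card_pos.2 ⟨w, hw⟩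
  have hcov : ∀ x ∈ K.verts, x = w ∨ x ∈ A ∨ x ∈ B := by
    intro x hx
    by_cases hxw : x = w
    · exact Or.inl hxw
    · have : x ∈ A ∪ B := hU ▸ Finset.mem_erase.2 ⟨hxw, hx⟩
      exact Or.inr (Finset.mem_union.1 this)
  have hE' : ∀ e ∈ K.edges, (G.tail e ∈ insert w A ∧ G.head e ∈ insert w A) ∨
      (G.tail e ∈ insert w B ∧ G.head e ∈ insert w B) := by
    intro e he
    have h1 := hcov _ (K.tail_mem e he)
    have h2 := hcov _ (K.head_mem e he)
    by_cases h : G.tail e ≠ w ∧ G.head e ≠ w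
    · have := hE e (Finset.mem_filter.2 ⟨he, h⟩)
      simp only [Finset.mem_insert]
      tauto
    · simp only [Finset.mem_insert]
      tauto
  have h1 := card_edges_le_of_separation hE'
  have hwA : (insert w A).card ≤ A.card + 1 := Finset.card_insert_le _ _
  have hwB : (insert w B).card ≤ B.card + 1 := Finset.card_insert_le _ _
  rcases balanced_card_edges_le_of_separation hs hK hb (insert w A) with h | h <;>
  rcases balanced_card_edges_le_of_separation hs hK hb (insert w B) with h' | h' <;>
  omega

end Counting

section NearBalanced

variable {V E Γ : Type} {G : GainedGraph V E Γ}

theorem exists_step_of_connected {K : Subgraph G} (hK : Connected G K) {w x : V}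
    (hw : w ∈ K.verts) (hx : x ∈ K.verts) (hxw : x ≠ w) :
    ∃ s : E × Bool, s.1 ∈ K.edges ∧ stepStart G s = w ∧ stepEnd G s ≠ w := by
  by_contra! h
  obtain ⟨L, hL⟩ := hK.2 w hw x hx
  refine hxw (hL.preserves (P := fun z => z = w) (fun e he => ⟨fun h1 => ?_, fun h1 => ?_⟩) rfl)
  · exact h (e, true) he h1
  · exact h (e, false) he h1

variable [CommGroup Γ]

/-- An invariant of the walks that start at `w` and do not pass through `w` internally. -/
theorem IsWalk.invariant {K : Subgraph G} {w : V} {J : V → Γ → Prop} (h0 : J w 1)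
    (hJ : ∀ x g s, J x g → (x ≠ w ∨ g = 1) → s.1 ∈ K.edges → stepStart G s = x →
      J (stepEnd G s) (g * stepGain G s)) {L : List (E × Bool)} {x : V} (hL : IsWalk G K L w x)
    (hw : ∀ y ∈ (L.map (stepEnd G)).dropLast, y ≠ w) : J x (walkGain G L) := by
  induction L using List.reverseRecOn generalizing x with
  | nil =>
    obtain ⟨rfl, -⟩ := hL
    simpa [walkGain] using h0
  | append_singleton L s ih =>
    rw [isWalk_concat] at hL
    obtain ⟨h1, h2, rfl⟩ := hL
    simp only [List.map_append, List.map_cons, List.map_nil, List.dropLast_concat] at hw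
    rw [walkGain_append, walkGain_singleton]
    refine hJ _ _ _ (ih h1 fun y hy => hw y (List.dropLast_subset _ hy)) ?_ h2 rfl
    rcases List.eq_nil_or_concat' L with rfl | ⟨L', t, rfl⟩
    · exact Or.inr (by simp [walkGain])
    · rw [isWalk_concat] at h1
      refine Or.inl (hw _ ?_)
      rw [← h1.2.2]
      simp

/-- There is a walk in `K` from `w` to `x` with gain `g` which does not pass through `w`
internally. -/
def AvoidingWalk (G : GainedGraph V E Γ) (K : Subgraph G) (w x : V) (g : Γ) : Prop :=
  ∃ L, IsWalk G K L w x ∧ (∀ y ∈ (L.map (stepEnd G)).dropLast, y ≠ w) ∧ walkGain G L = g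

theorem avoidingWalk_step {K : Subgraph G} {s : E × Bool} (h : s.1 ∈ K.edges) :
    AvoidingWalk G K (stepStart G s) (stepEnd G s) (stepGain G s) :=
  ⟨[s], isWalk_singleton h, by simp, walkGain_singleton s⟩

theorem AvoidingWalk.step {K : Subgraph G} {w : V} {g : Γ} {s : E × Bool}
    (h : AvoidingWalk G K w (stepStart G s) g) (hs : s.1 ∈ K.edges) (hw : stepStart G s ≠ w) :
    AvoidingWalk G K w (stepEnd G s) (g * stepGain G s) := by
  obtain ⟨L, h1, h2, rfl⟩ := h
  refine ⟨L ++ [s], isWalk_concat.2 ⟨h1, hs, rfl⟩, ?_, ?_⟩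
  · simp only [List.map_append, List.map_cons, List.map_nil, List.dropLast_concat]
    intro y hy
    rcases List.eq_nil_or_concat' L with rfl | ⟨L', t, rfl⟩
    · simp at hy
    · rw [isWalk_concat] at h1
      simp only [List.map_append, List.map_cons, List.map_nil, List.dropLast_concat,
        List.mem_append, List.mem_cons, List.not_mem_nil, or_false] at h2 hy
      rcases hy with hy | rfl
      · exact h2 y hy
      · exact h1.2.2 ▸ hw
  · rw [walkGain_append, walkGain_singleton]

theorem IsPotential.stepGain_eq {K : Subgraph G} {p : V → Γ} (hp : IsPotential G K ⊥ p)
    (hf : NoFixed G K) {s : E × Bool} (hs : s.1 ∈ K.edges) :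
    stepGain G s = (p (stepStart G s))⁻¹ * p (stepEnd G s) := by
  have := hp.step hs (hf _ (stepStart_mem hs)) (hf _ (stepEnd_mem hs))
  rw [Subgroup.mem_bot, mul_inv_eq_one] at this
  rw [← this, inv_mul_cancel_left]

/-- The union of two balanced subgraphs whose intersection becomes connected after deleting
the vertex `w` is near-balanced at `w`. -/
theorem nearBalancedAt_of_balanced [DecidableEq V] [DecidableEq E]
    {M₁ M₂ Y K : Subgraph G} {w : V}
    (hY : Y.edges ⊆ M₁.edges ∪ M₂.edges) (hf₁ : NoFixed G M₁) (hf₂ : NoFixed G M₂)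
    (hb₁ : Balanced G M₁) (hb₂ : Balanced G M₂)
    (hK : Connected G K) (hK₁ : K ≤ M₁) (hK₂ : K ≤ M₂)
    (hV : ∀ x ∈ M₁.verts, x ∈ M₂.verts → x ≠ w → x ∈ K.verts) (hu : ¬ Balanced G Y) :
    ∃ δ, NearBalancedAt G Y w δ := by
  obtain ⟨p₁, hp₁⟩ := exists_isPotential M₁ hb₁.le
  obtain ⟨p₂, hp₂⟩ := exists_isPotential M₂ hb₂.le
  obtain ⟨x₀, hx₀⟩ := hK.1
  have hagree : ∀ z ∈ M₁.verts, z ∈ M₂.verts → z ≠ w →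
      p₁ z = p₁ x₀ * (p₂ x₀)⁻¹ * p₂ z := by
    intro z h1 h2 h3
    have := (hp₁.mono hK₁).ratio hK (fun x hx => hf₁ x (hK₁.1 hx)) (hp₂.mono hK₂) hx₀
      (hV z h1 h2 h3)
    rw [Subgroup.mem_bot, mul_right_comm, mul_inv_eq_one] at this
    exact this.symm
  set c := p₁ x₀ * (p₂ x₀)⁻¹
  refine ⟨(p₁ w)⁻¹ * (c * p₂ w), hu, fun L hL hLw => ?_⟩
  let J : V → Γ → Prop := fun z g =>
    (z = w → g ∈ ({1, (p₁ w)⁻¹ * (c * p₂ w), ((p₁ w)⁻¹ * (c * p₂ w))⁻¹} : Set Γ)) ∧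
    (z ≠ w → ∃ a, (a = p₁ w ∨ a = c * p₂ w) ∧ (z ∈ M₁.verts → g = a⁻¹ * p₁ z) ∧
      (z ∈ M₂.verts → g = a⁻¹ * (c * p₂ z)))
  have hJ : J w (walkGain G L) := by
    refine hL.invariant (J := J) ⟨fun _ => by simp, fun h => (h rfl).elim⟩ ?_ hLw
    rintro x g s hxg hor hs rfl
    rcases Finset.mem_union.1 (hY hs) with h | h
    · obtain ⟨a, ha, rfl⟩ : ∃ a, (a = p₁ w ∨ a = c * p₂ w) ∧ g = a⁻¹ * p₁ (stepStart G s) := by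
        by_cases hx : stepStart G s = w
        · exact ⟨p₁ w, Or.inl rfl, by simpa [hx] using hor⟩
        · obtain ⟨a, ha, h1, -⟩ := hxg.2 hx
          exact ⟨a, ha, h1 (stepStart_mem h)⟩
      rw [hp₁.stepGain_eq hf₁ h, mul_assoc, mul_inv_cancel_left]
      refine ⟨fun hz => ?_, fun hz => ⟨a, ha, fun _ => rfl, fun h2 => ?_⟩⟩
      · rcases ha with rfl | rfl
        · simp [hz]
        · simp [hz, mul_comm]
      · rw [hagree _ (stepEnd_mem h) h2 hz]
    · obtain ⟨a, ha, rfl⟩ :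
          ∃ a, (a = p₁ w ∨ a = c * p₂ w) ∧ g = a⁻¹ * (c * p₂ (stepStart G s)) := by
        by_cases hx : stepStart G s = w
        · exact ⟨c * p₂ w, Or.inr rfl, by simpa [hx] using hor⟩
        · obtain ⟨a, ha, -, h1⟩ := hxg.2 hx
          exact ⟨a, ha, h1 (stepStart_mem h)⟩
      rw [hp₂.stepGain_eq hf₂ h, mul_assoc, mul_assoc c, mul_inv_cancel_left]
      refine ⟨fun hz => ?_, fun hz => ⟨a, ha, fun h1 => ?_, fun _ => rfl⟩⟩
      · rcases ha with rfl | rfl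
        · simp [hz]
        · simp [hz]
      · rw [hagree _ h1 (stepEnd_mem h) hz]
  exact hJ.1 rfl

/-- A walk inside a balanced subgraph avoiding `w` extends an avoiding walk. -/
theorem AvoidingWalk.extend [DecidableEq V] {K M : Subgraph G} {w x y : V} {g : Γ} {p : V → Γ}
    (h : AvoidingWalk G M w x g) (hKM : K ≤ M) (hf : NoFixed G K) (hp : IsPotential G K ⊥ p)
    (hxy : Reachable G (K.deleteVertex w) x y) :
    AvoidingWalk G M w y (g * (p x)⁻¹ * p y) := by
  obtain ⟨L, hL⟩ := hxy
  induction L generalizing x g with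
  | nil =>
    obtain ⟨rfl, -⟩ := hL
    simpa using h
  | cons s L ih =>
    obtain ⟨h1, rfl, h2⟩ := hL
    have hs : s.1 ∈ K.edges := (Finset.mem_filter.1 h1).1
    have hne : stepStart G s ≠ w := (Finset.mem_erase.1 (stepStart_mem h1)).1
    have := ih (h.step (hKM.2 hs) hne) h2
    rw [hp.stepGain_eq hf hs] at this
    convert this using 1
    group

/-- The union of a balanced subgraph and a subgraph that is near-balanced at `w` is
near-balanced at `w` if their intersection `K` is connected and has no cut-vertex at `w`. -/
theorem nearBalancedAt_union [DecidableEq V] [DecidableEq E]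
    {M₁ M₂ Y K : Subgraph G} {w : V} {δ : Γ}
    (hY : Y.edges ⊆ M₁.edges ∪ M₂.edges) (hf₁ : NoFixed G M₁)
    (hb₁ : Balanced G M₁) (hn : NearBalancedAt G M₂ w δ) (hw : w ∈ M₂.verts)
    (hK : Connected G K) (hKw : w ∈ K.verts → (K.deleteVertex w).verts.Nonempty →
      Connected G (K.deleteVertex w))
    (hK₁ : K ≤ M₁) (hK₂ : K ≤ M₂)
    (hV : ∀ x ∈ M₁.verts, x ∈ M₂.verts → x ∈ K.verts) (hu : ¬ Balanced G Y) :
    NearBalancedAt G Y w δ := by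
  have hfK : NoFixed G K := fun x hx => hf₁ x (hK₁.1 hx)
  obtain ⟨p, hp⟩ := exists_isPotential M₁ hb₁.le
  have hpK := hp.mono hK₁
  have hdel : ∀ x ∈ K.verts, x ≠ w → ∀ y ∈ K.verts, y ≠ w →
      Reachable G (K.deleteVertex w) x y := by
    intro x hx hxw y hy hyw
    have hx' : x ∈ (K.deleteVertex w).verts := Finset.mem_erase.2 ⟨hxw, hx⟩
    by_cases h : w ∈ K.verts
    · exact (hKw h ⟨x, hx'⟩).2 x hx' y (Finset.mem_erase.2 ⟨hyw, hy⟩)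
    · refine Reachable.transport (fun e he => ?_) (hK.2 x hx y hy) hx'
      exact reachable_edge (K := K.deleteVertex w) (Finset.mem_filter.2
        ⟨he, fun h' => h (h' ▸ K.tail_mem e he), fun h' => h (h' ▸ K.head_mem e he)⟩)
  refine ⟨hu, fun L hL hLw => ?_⟩
  set S : Set Γ := {1, δ, δ⁻¹} with hS
  have hSw : ∀ g, AvoidingWalk G M₂ w w g → g ∈ S := by
    rintro g ⟨L, h1, h2, rfl⟩
    exact hn.2 L h1 h2
  let Q : V → Γ → Prop := fun z g => (z = w ∧ g = 1) ∨ (z ≠ w ∧ AvoidingWalk G M₂ w z g)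
  let J : V → Γ → Prop := fun z g =>
    (z ∈ M₂.verts → (z = w → g ∈ S) ∧ (z ≠ w → AvoidingWalk G M₂ w z g)) ∧
    (z ∈ M₁.verts → z ∉ M₂.verts →
      ∃ z' ∈ K.verts, ∃ g', Q z' g' ∧ g = g' * (p z')⁻¹ * p z)
  have hQ : ∀ {z g s}, Q z g → s.1 ∈ M₂.edges → stepStart G s = z →
      AvoidingWalk G M₂ w (stepEnd G s) (g * stepGain G s) := by
    rintro z g s (⟨rfl, rfl⟩ | ⟨h1, h2⟩) hs h3
    · rw [one_mul, ← h3]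
      exact avoidingWalk_step hs
    · subst h3
      exact h2.step hs h1
  have hwalk : ∀ {z g y}, z ∈ K.verts → Q z g → y ∈ K.verts → y ≠ w →
      AvoidingWalk G M₂ w y (g * (p z)⁻¹ * p y) := by
    rintro z g y hz (⟨rfl, rfl⟩ | ⟨h1, h2⟩) hy hyw
    · obtain ⟨s, hs, rfl, hsw⟩ := exists_step_of_connected hK hz hy hyw
      have := (avoidingWalk_step (hK₂.2 hs)).extend hK₂ hfK hpK
        (hdel _ (stepEnd_mem hs) hsw y hy hyw)
      rw [hpK.stepGain_eq hfK hs] at this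
      simpa using this
    · exact h2.extend hK₂ hfK hpK (hdel _ hz h1 y hy hyw)
  have hclose : ∀ {z g}, z ∈ K.verts → Q z g → w ∈ K.verts → g * (p z)⁻¹ * p w ∈ S := by
    intro z g hz hq hwK
    by_cases hzw : z = w
    · rcases hq with ⟨-, rfl⟩ | ⟨h1, -⟩
      · simp [hzw, hS]
      · exact (h1 hzw).elim
    · obtain ⟨s, hs, rfl, hsw⟩ := exists_step_of_connected hK hwK hz hzw
      have h1 := hwalk hz hq (stepEnd_mem hs) hsw
      rw [← stepStart_rev] at h1
      have h2 := h1.step (hK₂.2 (show (stepRev s).1 ∈ K.edges from hs))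
        (by rwa [stepStart_rev])
      rw [stepStart_rev, stepEnd_rev, stepGain_rev, hpK.stepGain_eq hfK hs] at h2
      convert hSw _ h2 using 1
      simp
  have hJ : J w (walkGain G L) := by
    refine hL.invariant (J := J)
      ⟨fun _ => ⟨fun _ => by simp [hS], fun h => (h rfl).elim⟩, fun _ h => (h hw).elim⟩ ?_ hLw
    rintro x g s hxg hor hs rfl
    have hQ₂ : stepStart G s ∈ M₂.verts → Q (stepStart G s) g := by
      intro h
      by_cases hx : stepStart G s = w
      · exact Or.inl ⟨hx, by simpa [hx] using hor⟩
      · exact Or.inr ⟨hx, (hxg.1 h).2 hx⟩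
    rcases Finset.mem_union.1 (hY hs) with h | h
    · obtain ⟨z', hz', g', hq', rfl⟩ :
          ∃ z' ∈ K.verts, ∃ g', Q z' g' ∧ g = g' * (p z')⁻¹ * p (stepStart G s) := by
        by_cases hx : stepStart G s ∈ M₂.verts
        · exact ⟨_, hV _ (stepStart_mem h) hx, g, hQ₂ hx, by simp⟩
        · exact hxg.2 (stepStart_mem h) hx
      rw [hp.stepGain_eq hf₁ h, mul_assoc _ (p (stepStart G s)), mul_inv_cancel_left]
      refine ⟨fun h2 => ⟨fun hz => ?_, fun hz => ?_⟩, fun _ h2 => ⟨z', hz', g', hq', rfl⟩⟩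
      · rw [hz]
        exact hclose hz' hq' (hz ▸ hV _ (stepEnd_mem h) h2)
      · exact hwalk hz' hq' (hV _ (stepEnd_mem h) h2) hz
    · have h1 := hQ (hQ₂ (stepStart_mem h)) h rfl
      refine ⟨fun _ => ⟨fun hz => ?_, fun _ => h1⟩, fun _ h2 => (h2 (stepEnd_mem h)).elim⟩
      rw [hz] at h1
      exact hSw _ h1
  exact (hJ.1 hw).1 rfl

end NearBalanced

section Alpha

variable {V E : Type} {k j : ℕ}
  {G : GainedGraph V E (Multiplicative (ZMod k))}

theorem isZIso_iff {H : Subgraph G} {n : ℕ} :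
    IsZIso G H n ↔ Nat.card (gainGroup G H) = n := by
  constructor
  · rintro ⟨e⟩
    rw [Nat.card_congr e.toEquiv]
    exact Nat.card_zmod n
  · intro h
    refine ⟨mulEquivOfCyclicCardEq ?_⟩
    rw [h]
    exact (Nat.card_zmod n).symm

theorem balanced_iff_card {H : Subgraph G} :
    Balanced G H ↔ Nat.card (gainGroup G H) = 1 :=
  Subgroup.card_eq_one.symm

theorem isS_iff {H : Subgraph G} {i : ℤ} :
    IsS G k j i H ↔ Nat.card (gainGroup G H) ∈ SSet k j i := by
  simp only [IsS, isZIso_iff]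
  constructor
  · rintro ⟨n, hn, rfl⟩
    exact hn
  · exact fun h => ⟨_, h, rfl⟩

theorem isSpm_congr {X Y : Subgraph G} (h : gainGroup G X = gainGroup G Y) :
    IsSpm G k j X ↔ IsSpm G k j Y := by
  simp only [IsSpm, isS_iff, h]

theorem isS_congr {X Y : Subgraph G} (h : gainGroup G X = gainGroup G Y) {i : ℤ} :
    IsS G k j i X ↔ IsS G k j i Y := by
  simp only [isS_iff, h]

theorem isZIso_congr {X Y : Subgraph G} (h : gainGroup G X = gainGroup G Y) {n : ℕ} :
    IsZIso G X n ↔ IsZIso G Y n := by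
  simp only [isZIso_iff, h]

theorem balanced_congr {X Y : Subgraph G} (h : gainGroup G X = gainGroup G Y) :
    Balanced G X ↔ Balanced G Y := by
  simp only [Balanced, h]

theorem card_gainGroup_dvd (H : Subgraph G) : Nat.card (gainGroup G H) ∣ k := by
  have := Subgroup.card_subgroup_dvd_card (gainGroup G H)
  rwa [show Nat.card (Multiplicative (ZMod k)) = k from Nat.card_zmod k] at this

theorem gainGroup_le_of_card_dvd {X : Subgraph G} (h : Nat.card (gainGroup G X) ∣ j) :
    gainGroup G X ≤ (powMonoidHom j : Multiplicative (ZMod k) →* _).ker := by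
  intro g hg
  rw [MonoidHom.mem_ker, powMonoidHom_apply]
  obtain ⟨c, rfl⟩ := h
  have : (⟨g, hg⟩ : gainGroup G X) ^ Nat.card (gainGroup G X) = 1 := pow_card_eq_one'
  rw [pow_mul]
  have h2 : g ^ Nat.card (gainGroup G X) = 1 := congrArg Subtype.val this
  rw [h2, one_pow]

theorem card_dvd_of_gainGroup_le {X : Subgraph G}
    (h : gainGroup G X ≤ (powMonoidHom j : Multiplicative (ZMod k) →* _).ker) :
    Nat.card (gainGroup G X) ∣ j := by
  obtain ⟨g, hg⟩ := IsCyclic.exists_generator (α := gainGroup G X)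
  rw [← orderOf_eq_card_of_forall_mem_zpowers hg]
  refine orderOf_dvd_of_pow_eq_one (Subtype.ext ?_)
  exact h g.2

variable [DecidableEq V]

theorem alpha_nonneg {X : Subgraph G} (hc : X.fixedVerts.card ≤ 1) : 0 ≤ alpha G k j X := by
  unfold alpha
  split_ifs <;> omega

theorem alpha_le {X : Subgraph G} (hc : X.fixedVerts.card ≤ 1) :
    alpha G k j X ≤ 3 - 2 * (X.fixedVerts.card : ℤ) := by
  unfold alpha
  split_ifs <;> omega

theorem balanced_of_alpha_eq_zero {X : Subgraph G} (hc : X.fixedVerts.card = 0)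
    (h : alpha G k j X = 0) : Balanced G X := by
  unfold alpha at h
  split_ifs at h <;> first | assumption | omega

theorem isZIso_two_of_alpha_eq_one {X : Subgraph G} (hc : X.fixedVerts.card = 0)
    (h : alpha G k j X = 1) : Odd j ∧ IsZIso G X 2 := by
  unfold alpha at h
  split_ifs at h <;> first | assumption | omega

theorem alpha_eq_one {X : Subgraph G} (hj : Odd j) (h : IsZIso G X 2) : alpha G k j X = 1 := by
  have hb : ¬ Balanced G X := by
    rw [balanced_iff_card, isZIso_iff.1 h]
    norm_num
  rw [alpha, if_neg hb, if_pos ⟨hj, h⟩]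

theorem of_alpha_eq_two {X : Subgraph G} (hc : X.fixedVerts.card = 0)
    (h : alpha G k j X = 2) : (IsSpm G k j X ∨ IsS G k j 0 X) ∨ NearBalanced G X := by
  unfold alpha at h
  split_ifs at h with h1 h2 h3 h4 <;> first | omega | skip
  · exact Or.inl (Or.inl h3)
  · rcases h4 with h4 | h4
    · exact Or.inl (Or.inr h4)
    · exact Or.inr h4.2.1

theorem of_alpha_eq_three {X : Subgraph G} (hc : X.fixedVerts.card = 0)
    (h : alpha G k j X = 3) :
    ¬ Balanced G X ∧ ¬ (Odd j ∧ IsZIso G X 2) ∧ ¬ IsSpm G k j X ∧ ¬ IsS G k j 0 X := by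
  unfold alpha at h
  split_ifs at h with h1 h2 h3 h4 <;> first | omega | skip
  exact ⟨h1, h2, h3, fun h => h4 (Or.inl h)⟩

theorem alpha_eq_two_of_nearBalanced {X Y : Subgraph G} (hX : X.fixedVerts.card = 0)
    (hY : Y.fixedVerts.card = 0) (h : gainGroup G X = gainGroup G Y)
    (hα : alpha G k j X = 3) (hn : NearBalanced G Y) : alpha G k j Y = 2 := by
  obtain ⟨h1, h2, h3, h4⟩ := of_alpha_eq_three hX hα
  rw [balanced_congr h] at h1
  rw [isZIso_congr h] at h2
  rw [isSpm_congr h] at h3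
  rw [isS_congr h] at h4
  have hP : ProperNearBalanced G Y := by
    refine ⟨hn, fun hz => ?_, fun hz => ?_⟩
    · have hj : ¬ Odd j := fun hj => h2 ⟨hj, hz⟩
      rw [isS_iff, isZIso_iff.1 hz] at h4
      refine h4 ⟨le_rfl, ?_, fun hj' => (hj hj').elim, ?_⟩
      · have := card_gainGroup_dvd Y
        rwa [isZIso_iff.1 hz] at this
      · rw [Int.cast_zero, ZMod.natCast_eq_zero_iff]
        exact even_iff_two_dvd.1 (Nat.not_odd_iff_even.1 hj)
    · have hk : 3 ∣ k := by
        have := card_gainGroup_dvd Y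
        rwa [isZIso_iff.1 hz] at this
      have h5 : (j : ZMod 3) = 0 ∨ (j : ZMod 3) = 1 ∨ (j : ZMod 3) = -1 := by
        generalize (j : ZMod 3) = a
        revert a
        decide
      rw [IsSpm, isS_iff, isS_iff, isZIso_iff.1 hz] at h3
      rw [isS_iff, isZIso_iff.1 hz] at h4
      have h6 : ∀ i : ℤ, (j : ZMod 3) = i → 3 ∈ SSet k j i := fun i hi =>
        ⟨by norm_num, hk, fun _ => by norm_num, hi⟩
      rcases h5 with h5 | h5 | h5
      · exact h4 (h6 0 (by simpa using h5))
      · exact h3 (Or.inr (h6 1 (by simpa using h5)))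
      · exact h3 (Or.inl (h6 (-1) (by simpa using h5)))
  rw [alpha, if_neg h1, if_neg h2, if_neg h3, if_pos (Or.inr ⟨hY, hP⟩), hY]
  norm_num

theorem gainGroup_le_of_alpha_eq_zero {X : Subgraph G} (hc : X.fixedVerts.card ≤ 1)
    (h : alpha G k j X = 0) :
    gainGroup G X ≤ (powMonoidHom j : Multiplicative (ZMod k) →* _).ker := by
  apply gainGroup_le_of_card_dvd
  unfold alpha at h
  split_ifs at h with h1 h2 h3 h4 <;> first | omega | skip
  · rw [balanced_iff_card.1 h1]
    exact one_dvd j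
  · rcases h4 with h4 | h4
    · have := (isS_iff.1 h4).2.2.2
      rwa [Int.cast_zero, ZMod.natCast_eq_zero_iff] at this
    · omega

theorem alpha_eq_zero_of_gainGroup_le [NeZero k] {X : Subgraph G} (hc : X.fixedVerts.card = 1)
    (h : gainGroup G X ≤ (powMonoidHom j : Multiplicative (ZMod k) →* _).ker) :
    alpha G k j X = 0 := by
  have hd := card_dvd_of_gainGroup_le h
  by_cases hb : Balanced G X
  · exact if_pos hb
  have h1 : Nat.card (gainGroup G X) ≠ 1 := fun h => hb (balanced_iff_card.2 h)
  have h0 : 0 < Nat.card (gainGroup G X) := Nat.card_pos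
  have hodd : Odd j → Nat.card (gainGroup G X) ≠ 2 := by
    rintro hj h2
    rw [h2] at hd
    exact Nat.not_even_iff_odd.2 hj (even_iff_two_dvd.2 hd)
  have hj0 : ((j : ℕ) : ZMod (Nat.card (gainGroup G X))) = 0 :=
    (ZMod.natCast_eq_zero_iff _ _).2 hd
  have hS : IsS G k j 0 X := isS_iff.2
    ⟨by omega, card_gainGroup_dvd X, hodd, by simpa using hj0⟩
  have hspm : ¬ IsSpm G k j X := by
    have : Fact (1 < Nat.card (gainGroup G X)) := ⟨by omega⟩
    rw [IsSpm, isS_iff, isS_iff]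
    rintro (⟨-, -, -, h⟩ | ⟨-, -, -, h⟩)
    · rw [hj0] at h
      simp at h
    · rw [hj0] at h
      simp at h
  rw [alpha, if_neg hb, if_neg (fun h => hodd h.1 (isZIso_iff.1 h.2)), if_neg hspm,
    if_pos (Or.inl hS), hc]
  norm_num

end Alpha

section OneReduction

variable {V E Γ : Type} {G : GainedGraph V E Γ}

theorem step_eq_of_edge_eq {K : Subgraph G} {v : V} (hloop : ¬ HasLoopAt G K v) {s t : E × Bool}
    (hs : s.1 ∈ K.edges) (hsv : stepStart G s = v) (htv : stepStart G t = v) (h : s.1 = t.1) :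
    s = t := by
  obtain ⟨e, b⟩ := s
  obtain ⟨e', b'⟩ := t
  obtain rfl : e = e' := h
  cases b <;> cases b' <;> simp_all [stepStart, HasLoopAt]

/-- The edges of `K` at the vertex `v`. -/
def edgesAt [DecidableEq V] (K : Subgraph G) (v : V) : Finset E :=
  K.edges.filter fun e => G.tail e = v ∨ G.head e = v

theorem fst_mem_edgesAt [DecidableEq V] {K : Subgraph G} {v : V} {s : E × Bool}
    (hs : s.1 ∈ K.edges) (hsv : stepStart G s = v) : s.1 ∈ edgesAt K v := by
  refine Finset.mem_filter.2 ⟨hs, ?_⟩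
  unfold stepStart at hsv
  split_ifs at hsv
  · exact Or.inl hsv
  · exact Or.inr hsv

theorem card_edgesAt [DecidableEq V] {K : Subgraph G} {v : V} (hloop : ¬ HasLoopAt G K v) :
    (edgesAt K v).card = degree G K v := by
  rw [edgesAt, degree, Finset.filter_or, Finset.card_union_of_disjoint]
  rw [Finset.disjoint_left]
  intro e h1 h2
  rw [Finset.mem_filter] at h1 h2
  exact hloop ⟨e, h1.1, h1.2, h2.2⟩

variable [CommGroup Γ]

/-- The edge `f`, traversed in one of its two directions, has the endpoints and the gain of the
path of length two that runs through the steps `x` and `y` leaving a common vertex. -/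
def Joins (G : GainedGraph V E Γ) (f : E) (x y : E × Bool) : Prop :=
  (G.tail f = stepEnd G x ∧ G.head f = stepEnd G y ∧
      G.gain f = (stepGain G x)⁻¹ * stepGain G y) ∨
    (G.tail f = stepEnd G y ∧ G.head f = stepEnd G x ∧
      G.gain f = (stepGain G y)⁻¹ * stepGain G x)

theorem Joins.symm {f : E} {x y : E × Bool} (h : Joins G f x y) : Joins G f y x := Or.symm h

theorem Joins.sameEdge {f₁ f₂ : E} {x y : E × Bool} (h₁ : Joins G f₁ x y)
    (h₂ : Joins G f₂ x y) : SameEdge G f₁ f₂ := by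
  rcases h₁ with ⟨a, b, c⟩ | ⟨a, b, c⟩ <;> rcases h₂ with ⟨a', b', c'⟩ | ⟨a', b', c'⟩
  · exact Or.inl ⟨a.trans a'.symm, b.trans b'.symm, c.trans c'.symm⟩
  · exact Or.inr ⟨a.trans b'.symm, b.trans a'.symm, by simp [c, c']⟩
  · exact Or.inr ⟨a.trans b'.symm, b.trans a'.symm, by simp [c, c']⟩
  · exact Or.inl ⟨a.trans a'.symm, b.trans b'.symm, c.trans c'.symm⟩

theorem IsOneReduction.exists_joins {K : Subgraph G} {v : V} {f : E}
    (h : IsOneReduction G K v f) :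
    ∃ x y : E × Bool, x.1 ∈ K.edges ∧ y.1 ∈ K.edges ∧ x.1 ≠ y.1 ∧ stepStart G x = v ∧
      stepStart G y = v ∧ Joins G f x y := by
  obtain ⟨-, -, -, s, t, hs, ht, hst, hsv, htv, h1, h2, h3⟩ := h
  refine ⟨stepRev s, t, hs, ht, hst, (stepStart_rev s).trans hsv, htv, Or.inl ⟨?_, h2, ?_⟩⟩
  · rw [stepEnd_rev, h1]
  · rw [stepGain_rev, inv_inv, h3]

/-- Two different 1-reductions at a vertex of degree three use paths sharing exactly one edge. -/
theorem exists_joins_pair [DecidableEq V] {K : Subgraph G} {v : V} {f₁ f₂ : E}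
    (hdeg : degree G K v = 3) (hloop : ¬ HasLoopAt G K v) (hf₁ : IsOneReduction G K v f₁)
    (hf₂ : IsOneReduction G K v f₂) (hdiff : ¬ SameEdge G f₁ f₂) :
    ∃ x y z : E × Bool, x.1 ∈ edgesAt K v ∧
      (∀ e ∈ edgesAt K v, e = x.1 ∨ e = y.1 ∨ e = z.1) ∧
      stepStart G x = v ∧ stepStart G y = v ∧ stepStart G z = v ∧
      y.1 ∈ edgesAt K v ∧ z.1 ∈ edgesAt K v ∧ Joins G f₁ x y ∧ Joins G f₂ x z := by
  rw [← card_edgesAt hloop] at hdeg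
  have key : ∀ x y z : E × Bool, x.1 ∈ K.edges → y.1 ∈ K.edges → z.1 ∈ K.edges →
      stepStart G x = v → stepStart G y = v → stepStart G z = v → x.1 ≠ y.1 → x.1 ≠ z.1 →
      Joins G f₁ x y → Joins G f₂ x z →
      ∃ x y z : E × Bool, x.1 ∈ edgesAt K v ∧
        (∀ e ∈ edgesAt K v, e = x.1 ∨ e = y.1 ∨ e = z.1) ∧
        stepStart G x = v ∧ stepStart G y = v ∧ stepStart G z = v ∧
        y.1 ∈ edgesAt K v ∧ z.1 ∈ edgesAt K v ∧ Joins G f₁ x y ∧ Joins G f₂ x z := by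
    intro x y z hx hy hz hxv hyv hzv hxy hxz h1 h2
    refine ⟨x, y, z, fst_mem_edgesAt hx hxv, ?_, hxv, hyv, hzv, fst_mem_edgesAt hy hyv,
      fst_mem_edgesAt hz hzv, h1, h2⟩
    have hyz : y.1 ≠ z.1 := by
      intro h
      rw [step_eq_of_edge_eq hloop hy hyv hzv h] at h1
      exact hdiff (h1.sameEdge h2)
    have hsub : ({x.1, y.1, z.1} : Finset E) ⊆ edgesAt K v := by
      intro e he
      simp only [Finset.mem_insert, Finset.mem_singleton] at he
      rcases he with rfl | rfl | rfl
      · exact fst_mem_edgesAt hx hxv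
      · exact fst_mem_edgesAt hy hyv
      · exact fst_mem_edgesAt hz hzv
    have heq := Finset.eq_of_subset_of_card_le hsub (by
      rw [hdeg, Finset.card_eq_three.2 ⟨x.1, y.1, z.1, hxy, hxz, hyz, rfl⟩])
    intro e he
    rw [← heq] at he
    simpa using he
  obtain ⟨a, b, ha, hb, hab, hav, hbv, h1⟩ := hf₁.exists_joins
  obtain ⟨c, d, hc, hd, hcd, hcv, hdv, h2⟩ := hf₂.exists_joins
  by_cases hac : a = c
  · subst hac
    exact key a b d ha hb hd hav hbv hdv hab hcd h1 h2
  by_cases had : a = d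
  · subst had
    exact key a b c ha hb hc hav hbv hcv hab hcd.symm h1 h2.symm
  by_cases hbc : b = c
  · subst hbc
    exact key b a d hb ha hd hbv hav hdv hab.symm hcd h1.symm h2
  by_cases hbd : b = d
  · subst hbd
    exact key b a c hb ha hc hbv hav hcv hab.symm hcd.symm h1.symm h2.symm
  exfalso
  have hne : ∀ {s t : E × Bool}, s.1 ∈ K.edges → stepStart G s = v → stepStart G t = v →
      s ≠ t → s.1 ≠ t.1 :=
    fun hs hsv htv hst h => hst (step_eq_of_edge_eq hloop hs hsv htv h)
  have hsub : ({a.1, b.1, c.1, d.1} : Finset E) ⊆ edgesAt K v := by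
    intro e he
    simp only [Finset.mem_insert, Finset.mem_singleton] at he
    rcases he with rfl | rfl | rfl | rfl
    · exact fst_mem_edgesAt ha hav
    · exact fst_mem_edgesAt hb hbv
    · exact fst_mem_edgesAt hc hcv
    · exact fst_mem_edgesAt hd hdv
  have := Finset.card_le_card hsub
  rw [Finset.card_insert_of_notMem, Finset.card_eq_three.2 ⟨b.1, c.1, d.1,
    hne hb hbv hcv hbc, hne hb hbv hdv hbd, hcd, rfl⟩] at this
  · omega
  · simp only [Finset.mem_insert, Finset.mem_singleton, not_or]
    exact ⟨hab, hne ha hav hcv hac, hne ha hav hdv had⟩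

end OneReduction

section Substitution

variable {V E Γ : Type} {G : GainedGraph V E Γ}

theorem exists_step_from {K : Subgraph G} (hK : Connected G K) {f : E} (hf : f ∈ K.edges) {u : V}
    (hu : u ∈ K.verts) : ∃ s : E × Bool, s.1 ∈ K.edges ∧ stepStart G s = u := by
  obtain ⟨L, hL⟩ := hK.2 u hu _ (K.tail_mem f hf)
  cases L with
  | nil => exact ⟨(f, true), hf, hL.1.symm⟩
  | cons s L => exact ⟨s, hL.1, hL.2.1⟩

variable [CommGroup Γ]

theorem Joins.stepEnd_mem {f : E} {x y : E × Bool} (h : Joins G f x y) {A : Finset V}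
    (ht : G.tail f ∈ A) (hh : G.head f ∈ A) : stepEnd G x ∈ A ∧ stepEnd G y ∈ A := by
  rcases h with ⟨h1, h2, -⟩ | ⟨h1, h2, -⟩
  · exact ⟨h1 ▸ ht, h2 ▸ hh⟩
  · exact ⟨h2 ▸ hh, h1 ▸ ht⟩

theorem Joins.endpoint {f : E} {x y : E × Bool} (h : Joins G f x y) {s : E × Bool}
    (hs : s.1 = f) : stepStart G s = stepEnd G x ∨ stepStart G s = stepEnd G y := by
  subst hs
  unfold stepStart
  rcases h with ⟨h1, h2, -⟩ | ⟨h1, h2, -⟩ <;> split_ifs <;> simp [h1, h2]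

theorem Joins.reachable {f : E} {x y : E × Bool} (h : Joins G f x y) {K : Subgraph G}
    (hx : x.1 ∈ K.edges) (hy : y.1 ∈ K.edges) (hxy : stepStart G x = stepStart G y) :
    Reachable G K (G.tail f) (G.head f) := by
  have h0 : Reachable G K (stepEnd G x) (stepEnd G y) := by
    refine (reachable_step hx).symm.trans ?_
    rw [hxy]
    exact reachable_step hy
  rcases h with ⟨h1, h2, -⟩ | ⟨h1, h2, -⟩ <;> rw [h1, h2]
  · exact h0
  · exact h0.symm

theorem IsPotential.of_joins {Y : Subgraph G} {N : Subgroup Γ} {p : V → Γ}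
    (hp : IsPotential G Y N p) (hY : NoFixed G Y) {f : E} {x y : E × Bool} (hf : f ∈ Y.edges)
    (h : Joins G f x y) :
    p (stepEnd G x) * (stepGain G x)⁻¹ * stepGain G y * (p (stepEnd G y))⁻¹ ∈ N := by
  have h0 := hp f hf (hY _ (Y.tail_mem f hf)) (hY _ (Y.head_mem f hf))
  rcases h with ⟨h1, h2, h3⟩ | ⟨h1, h2, h3⟩ <;> rw [h1, h2, h3] at h0
  · rwa [← mul_assoc] at h0
  · convert N.inv_mem h0 using 1
    simp only [mul_inv, inv_inv]
    simp only [mul_comm, mul_left_comm]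

theorem mem_of_step_mem {N : Subgroup Γ} {p : V → Γ} {s : E × Bool}
    (h : p (stepStart G s) * stepGain G s * (p (stepEnd G s))⁻¹ ∈ N) :
    p (G.tail s.1) * G.gain s.1 * (p (G.head s.1))⁻¹ ∈ N := by
  rcases s with ⟨e, _ | _⟩
  · convert N.inv_mem h using 1
    simp only [stepStart, stepEnd, stepGain, Bool.false_eq_true, if_false, mul_inv, inv_inv]
    simp only [mul_comm, mul_left_comm]
  · exact h

/-- Replacing the edges at a vertex `v` by edges with the gains of the paths of length two
through `v` does not change the gain group. -/
theorem gainGroup_eq_of_joins [DecidableEq V] {X Y : Subgraph G} {v : V} {f₁ f₂ : E}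
    {x y z : E × Bool}
    (hXY : ∀ e ∈ X.edges, e ∈ Y.edges ∨ e = x.1 ∨ e = y.1 ∨ e = z.1)
    (hYX : ∀ e ∈ Y.edges, e ∈ X.edges ∨ e = f₁ ∨ e = f₂)
    (hf₁ : f₁ ∈ Y.edges) (hf₂ : f₂ ∈ Y.edges)
    (hx : x.1 ∈ X.edges) (hy : y.1 ∈ X.edges) (hz : z.1 ∈ X.edges)
    (hxv : stepStart G x = v) (hyv : stepStart G y = v) (hzv : stepStart G z = v)
    (hv : v ∉ Y.verts) (hX : NoFixed G X) (hY : NoFixed G Y)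
    (h₁ : Joins G f₁ x y) (h₂ : Joins G f₂ x z) : gainGroup G X = gainGroup G Y := by
  apply le_antisymm
  · obtain ⟨p, hp⟩ := exists_isPotential Y (le_refl (gainGroup G Y))
    have hne : ∀ {u}, u ∈ Y.verts → u ≠ v := fun hu h => hv (h ▸ hu)
    have hxe := hne (h₁.stepEnd_mem (Y.tail_mem f₁ hf₁) (Y.head_mem f₁ hf₁)).1
    have hye := hne (h₁.stepEnd_mem (Y.tail_mem f₁ hf₁) (Y.head_mem f₁ hf₁)).2
    have hze := hne (h₂.stepEnd_mem (Y.tail_mem f₂ hf₂) (Y.head_mem f₂ hf₂)).2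
    refine IsPotential.gainGroup_le
      (p := Function.update p v (p (stepEnd G x) * (stepGain G x)⁻¹)) ?_
    intro e he ht hh
    rcases hXY e he with h | rfl | rfl | rfl
    · rw [Function.update_of_ne (hne (Y.tail_mem e h)),
        Function.update_of_ne (hne (Y.head_mem e h))]
      exact hp e h ht hh
    · apply mem_of_step_mem
      rw [hxv, Function.update_self, Function.update_of_ne hxe]
      simp
    · apply mem_of_step_mem
      rw [hyv, Function.update_self, Function.update_of_ne hye]
      exact hp.of_joins hY hf₁ h₁
    · apply mem_of_step_mem
      rw [hzv, Function.update_self, Function.update_of_ne hze]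
      exact hp.of_joins hY hf₂ h₂
  · obtain ⟨p, hp⟩ := exists_isPotential X (le_refl (gainGroup G X))
    have key : ∀ {f : E} {s t : E × Bool}, s.1 ∈ X.edges → t.1 ∈ X.edges →
        stepStart G s = v → stepStart G t = v → Joins G f s t →
        p (G.tail f) * G.gain f * (p (G.head f))⁻¹ ∈ gainGroup G X := by
      intro f s t hs ht hsv htv h
      have a := hp.step hs (hX _ (stepStart_mem hs)) (hX _ (GR.stepEnd_mem hs))
      have b := hp.step ht (hX _ (stepStart_mem ht)) (hX _ (GR.stepEnd_mem ht))
      rw [hsv] at a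
      rw [htv] at b
      rcases h with ⟨h1, h2, h3⟩ | ⟨h1, h2, h3⟩ <;> rw [h1, h2, h3]
      · convert mul_mem (inv_mem a) b using 1
        rw [eq_inv_mul_iff_mul_eq]
        group
      · convert mul_mem (inv_mem b) a using 1
        rw [eq_inv_mul_iff_mul_eq]
        group
    refine IsPotential.gainGroup_le (p := p) ?_
    intro e he ht hh
    rcases hYX e he with h | rfl | rfl
    · exact hp e h ht hh
    · exact key hx hy hxv hyv h₁
    · exact key hx hz hxv hzv h₂

end Substitution

section UnionAlpha

variable {V E : Type} {k j : ℕ} {G : GainedGraph V E (Multiplicative (ZMod k))}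

theorem NoFixed.mono {K K' : Subgraph G} (h : K ≤ K') (hK : NoFixed G K') : NoFixed G K :=
  fun x hx => hK x (h.1 hx)

theorem gainGroup_eq_ker_of_isZIso [NeZero k] {X : Subgraph G} {n : ℕ} (h : IsZIso G X n) :
    gainGroup G X = (powMonoidHom n : Multiplicative (ZMod k) →* _).ker := by
  have hc := isZIso_iff.1 h
  refine Subgroup.eq_of_le_of_card_ge (gainGroup_le_of_card_dvd hc.dvd) ?_
  have hn : n ∣ Nat.card (Multiplicative (ZMod k)) := hc ▸ Subgroup.card_subgroup_dvd_card _
  rw [IsCyclic.card_powMonoidHom_ker, Nat.gcd_eq_right hn, hc]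

variable [DecidableEq V]

theorem card_fixedVerts_mono {K K' : Subgraph G} (h : K ≤ K') :
    K.fixedVerts.card ≤ K'.fixedVerts.card :=
  Finset.card_le_card (Finset.inter_subset_inter_right h.1)

theorem noFixed_iff {K : Subgraph G} : NoFixed G K ↔ K.fixedVerts.card = 0 := by
  rw [Finset.card_eq_zero, Subgraph.fixedVerts, ← Finset.disjoint_iff_inter_eq_empty,
    Finset.disjoint_left]
  rfl

theorem alpha_union_of_balanced [DecidableEq E] {G₀ I M₁ M₂ X Y : Subgraph G}
    (hs : GainSparseKJ G k j G₀)
    (hI : I ≤ G₀) (hb : Balanced G I) (hne : I.edges.Nonempty) (hIc : Connected G I)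
    (hY : Y.edges ⊆ M₁.edges ∪ M₂.edges) (hM₁ : M₁ ≤ Y) (hM₂ : M₂ ≤ Y) (hI₁ : I ≤ M₁)
    (hI₂ : I ≤ M₂) (hV : ∀ x ∈ M₁.verts, x ∈ M₂.verts → x ∈ I.verts)
    (hX : X.fixedVerts.card = 0) (hYf : NoFixed G Y) (hXY : gainGroup G X = gainGroup G Y)
    (h₁ : alpha G k j M₁ = 0)
    (hcount : alpha G k j M₂ + (2 * (I.verts.card : ℤ) - 3 - I.edges.card) + 1 ≤ alpha G k j X) :
    alpha G k j Y = alpha G k j M₂ + (2 * (I.verts.card : ℤ) - 3 - I.edges.card) := by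
  have hd := balanced_card_edges_le hs hI hb hne
  have hf₁ := noFixed_iff.1 (hYf.mono hM₁)
  have hf₂ := noFixed_iff.1 (hYf.mono hM₂)
  have hle := alpha_le (k := k) (j := j) (X := X) (by omega)
  have h0 := alpha_nonneg (k := k) (j := j) (X := M₂) (by omega)
  have hb₁ := balanced_of_alpha_eq_zero hf₁ h₁
  have hgg : gainGroup G Y = gainGroup G M₂ :=
    le_antisymm (gainGroup_union_le hY hIc (hYf.mono (subgraph_le_trans hI₁ hM₁)) hI₁ hI₂
      (fun x hx hx' _ => hV x hx hx') (hb₁.le.trans bot_le) le_rfl) (gainGroup_mono hM₂)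
  rw [hX] at hle
  have h2 : alpha G k j M₂ = 0 ∨ alpha G k j M₂ = 1 ∨ alpha G k j M₂ = 2 := by omega
  rcases h2 with h2 | h2 | h2
  · have : Balanced G X :=
      (balanced_congr (hXY.trans hgg)).2 (balanced_of_alpha_eq_zero hf₂ h2)
    have : alpha G k j X = 0 := if_pos this
    omega
  · obtain ⟨hj, hz⟩ := isZIso_two_of_alpha_eq_one hf₂ h2
    have := alpha_eq_one hj ((isZIso_congr (hXY.trans hgg)).2 hz)
    omega
  · have h3 : alpha G k j X = 3 := by omega
    obtain ⟨hX1, -, hX3, hX4⟩ := of_alpha_eq_three hX h3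
    rw [balanced_congr hXY] at hX1
    rw [isSpm_congr (hXY.trans hgg)] at hX3
    rw [isS_congr (hXY.trans hgg)] at hX4
    rcases of_alpha_eq_two hf₂ h2 with (h | h) | ⟨-, w, hw, δ, hn⟩
    · exact (hX3 h).elim
    · exact (hX4 h).elim
    · have hnb : NearBalanced G Y := by
        refine ⟨hYf, w, hM₂.1 hw, δ, nearBalancedAt_union hY (hYf.mono hM₁) hb₁ hn hw hIc ?_
          hI₁ hI₂ hV hX1⟩
        exact connected_deleteVertex_of_tight hs hI hb hne (by omega)
      have := alpha_eq_two_of_nearBalanced hX (noFixed_iff.1 hYf) hXY h3 hnb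
      omega

variable [NeZero k]

theorem alpha_union_of_noFixed [DecidableEq E] {G₀ I M₁ M₂ X Y : Subgraph G}
    (hs : GainSparseKJ G k j G₀)
    (hI : I ≤ G₀) (hb : Balanced G I) (hne : I.edges.Nonempty)
    (hY : Y.edges ⊆ M₁.edges ∪ M₂.edges) (hM₁ : M₁ ≤ Y) (hM₂ : M₂ ≤ Y) (hI₁ : I ≤ M₁)
    (hI₂ : I ≤ M₂) (hV : ∀ x ∈ M₁.verts, x ∈ M₂.verts → x ∈ I.verts)
    (hX : X.fixedVerts.card = 0) (hYf : NoFixed G Y) (hXY : gainGroup G X = gainGroup G Y)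
    (hcount : alpha G k j M₁ + alpha G k j M₂ + (2 * (I.verts.card : ℤ) - 3 - I.edges.card) + 1 ≤
      alpha G k j X) :
    alpha G k j Y =
      alpha G k j M₁ + alpha G k j M₂ + (2 * (I.verts.card : ℤ) - 3 - I.edges.card) := by
  have hd := balanced_card_edges_le hs hI hb hne
  have hf₁ := noFixed_iff.1 (hYf.mono hM₁)
  have hf₂ := noFixed_iff.1 (hYf.mono hM₂)
  have hle := alpha_le (k := k) (j := j) (X := X) (by omega)
  have h0₁ := alpha_nonneg (k := k) (j := j) (X := M₁) (by omega)
  have h0₂ := alpha_nonneg (k := k) (j := j) (X := M₂) (by omega)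
  rw [hX] at hle
  by_cases hIc : Connected G I
  · by_cases h1 : alpha G k j M₁ = 0
    · rw [h1, zero_add] at hcount ⊢
      exact alpha_union_of_balanced hs hI hb hne hIc hY hM₁ hM₂ hI₁ hI₂ hV hX hYf hXY h1 hcount
    by_cases h2 : alpha G k j M₂ = 0
    · rw [h2, add_zero] at hcount ⊢
      exact alpha_union_of_balanced hs hI hb hne hIc (Finset.union_comm M₁.edges _ ▸ hY) hM₂ hM₁
        hI₂ hI₁ (fun x hx hx' => hV x hx' hx) hX hYf hXY h2 hcount
    obtain ⟨hj, hz₁⟩ := isZIso_two_of_alpha_eq_one (k := k) (j := j) hf₁ (by omega)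
    obtain ⟨-, hz₂⟩ := isZIso_two_of_alpha_eq_one (k := k) (j := j) hf₂ (by omega)
    have hgg : gainGroup G Y = gainGroup G M₂ :=
      le_antisymm (gainGroup_union_le hY hIc (hYf.mono (subgraph_le_trans hI₁ hM₁)) hI₁ hI₂
        (fun x hx hx' _ => hV x hx hx')
        ((gainGroup_eq_ker_of_isZIso hz₁).trans (gainGroup_eq_ker_of_isZIso hz₂).symm).le le_rfl)
        (gainGroup_mono hM₂)
    have := alpha_eq_one hj ((isZIso_congr (hXY.trans hgg)).2 hz₂)
    omega
  · have hd2 := balanced_not_connected_card_le hs hI hb hne hIc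
    have hb₁ := balanced_of_alpha_eq_zero (k := k) (j := j) hf₁ (by omega)
    have hb₂ := balanced_of_alpha_eq_zero (k := k) (j := j) hf₂ (by omega)
    have h3 : alpha G k j X = 3 := by omega
    have hu : ¬ Balanced G Y := fun h =>
      (of_alpha_eq_three hX h3).1 ((balanced_congr hXY).2 h)
    obtain ⟨w, hw, hwc⟩ := exists_connected_deleteVertex hs hI hb hne hIc (by omega)
    have hdel := deleteVertex_le I w
    obtain ⟨δ, hn⟩ := nearBalancedAt_of_balanced (w := w) hY (hYf.mono hM₁) (hYf.mono hM₂) hb₁ hb₂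
      hwc (subgraph_le_trans hdel hI₁) (subgraph_le_trans hdel hI₂)
      (fun x hx hx' hxw => Finset.mem_erase.2 ⟨hxw, hV x hx hx'⟩) hu
    have := alpha_eq_two_of_nearBalanced hX (noFixed_iff.1 hYf) hXY h3
      ⟨hYf, w, hM₁.1 (hI₁.1 hw), δ, hn⟩
    omega

theorem alpha_union_of_fixed [DecidableEq E] {G₀ I M₁ M₂ X Y : Subgraph G}
    (hs : GainSparseKJ G k j G₀)
    (hI : I ≤ G₀) (hb : Balanced G I) (hne : I.edges.Nonempty)
    (hloop : ∀ e ∈ I.edges, G.tail e = G.head e → G.tail e ∉ G.fixed)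
    (hY : Y.edges ⊆ M₁.edges ∪ M₂.edges) (hM₁ : M₁ ≤ Y) (hM₂ : M₂ ≤ Y) (hI₁ : I ≤ M₁)
    (hI₂ : I ≤ M₂) (hV : ∀ x ∈ M₁.verts, x ∈ M₂.verts → x ∈ I.verts)
    (hX : X.fixedVerts.card = 1) (hYf : Y.fixedVerts.card = 1)
    (hcount : alpha G k j M₁ + alpha G k j M₂ + (2 * (I.verts.card : ℤ) - 3 - I.edges.card) + 1 ≤
      alpha G k j X) :
    alpha G k j Y =
      alpha G k j M₁ + alpha G k j M₂ + (2 * (I.verts.card : ℤ) - 3 - I.edges.card) := by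
  have hd := balanced_card_edges_le hs hI hb hne
  have hf₁ := (card_fixedVerts_mono hM₁).trans hYf.le
  have hf₂ := (card_fixedVerts_mono hM₂).trans hYf.le
  have hle := alpha_le (k := k) (j := j) hX.le
  have h0₁ := alpha_nonneg (k := k) (j := j) hf₁
  have h0₂ := alpha_nonneg (k := k) (j := j) hf₂
  rw [hX] at hle
  have hIc : Connected G I := by
    by_contra hIc
    have := balanced_not_connected_card_le hs hI hb hne hIc
    omega
  have h1 := gainGroup_le_of_alpha_eq_zero (k := k) (j := j) hf₁ (by omega)
  have h2 := gainGroup_le_of_alpha_eq_zero (k := k) (j := j) hf₂ (by omega)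
  have hg : gainGroup G Y ≤ (powMonoidHom j : Multiplicative (ZMod k) →* _).ker := by
    obtain ⟨v₀, hv₀⟩ := Finset.card_eq_one.1 hYf
    have hv₀f : v₀ ∈ G.fixed :=
      (Finset.mem_inter.1 (hv₀ ▸ Finset.mem_singleton_self v₀ : v₀ ∈ Y.fixedVerts)).2
    have hfix : ∀ x ∈ I.verts, x ∈ G.fixed → x = v₀ := fun x hx hxf =>
      Finset.mem_singleton.1 (hv₀ ▸ Finset.mem_inter.2 ⟨hM₁.1 (hI₁.1 hx), hxf⟩)
    by_cases hv : v₀ ∈ I.verts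
    · have hdel := deleteVertex_le I v₀
      obtain ⟨e, he⟩ := hne
      have hne' : (I.deleteVertex v₀).verts.Nonempty := by
        by_cases ht : G.tail e = v₀
        · refine ⟨G.head e, Finset.mem_erase.2 ⟨fun hh => ?_, I.head_mem e he⟩⟩
          exact hloop e he (ht.trans hh.symm) (ht ▸ hv₀f)
        · exact ⟨G.tail e, Finset.mem_erase.2 ⟨ht, I.tail_mem e he⟩⟩
      have hc := connected_deleteVertex_of_tight hs hI hb ⟨e, he⟩ (by omega) hv hne'
      refine gainGroup_union_le hY hc (fun x hx hxf => ?_) (subgraph_le_trans hdel hI₁)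
        (subgraph_le_trans hdel hI₂) (fun x hx hx' hxf => ?_) h1 h2
      · exact (Finset.mem_erase.1 hx).1 (hfix x (Finset.mem_erase.1 hx).2 hxf)
      · exact Finset.mem_erase.2 ⟨fun h => hxf (h ▸ hv₀f), hV x hx hx'⟩
    · exact gainGroup_union_le hY hIc (fun x hx hxf => hv (hfix x hx hxf ▸ hx)) hI₁ hI₂
        (fun x hx hx' _ => hV x hx hx') h1 h2
  rw [alpha_eq_zero_of_gainGroup_le hYf hg]
  omega

end UnionAlpha

section OneReductionUnion

variable {V E Γ : Type} [DecidableEq V] {G : GainedGraph V E Γ}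

theorem addEdge_verts [DecidableEq E] {K : Subgraph G} {f : E} (ht : G.tail f ∈ K.verts)
    (hh : G.head f ∈ K.verts) : (K.addEdge f).verts = K.verts := by
  change insert (G.tail f) (insert (G.head f) K.verts) = K.verts
  rw [Finset.insert_eq_of_mem hh, Finset.insert_eq_of_mem ht]

theorem mem_edgeSpan_of_step {F : Finset E} {s : E × Bool} (hs : s.1 ∈ F) :
    stepStart G s ∈ (edgeSpan G F).verts ∧ stepEnd G s ∈ (edgeSpan G F).verts :=
  ⟨stepStart_mem (K := edgeSpan G F) hs, stepEnd_mem (K := edgeSpan G F) hs⟩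

variable [CommGroup Γ]

theorem mem_edgeSpan_of_addEdge [DecidableEq E] {K : Subgraph G} {f : E} {F : Finset E}
    {x y : E × Bool} (hK : Connected G (K.addEdge f)) (hKF : K.edges ⊆ F) (hx : x.1 ∈ F)
    (hy : y.1 ∈ F) (h : Joins G f x y) {u : V} (hu : u ∈ (K.addEdge f).verts) :
    u ∈ (edgeSpan G F).verts := by
  obtain ⟨s, hs, rfl⟩ := exists_step_from hK (Finset.mem_insert_self f K.edges) hu
  rcases Finset.mem_insert.1 hs with hs | hs
  · rcases h.endpoint hs with h | h <;> rw [h]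
    · exact (mem_edgeSpan_of_step hx).2
    · exact (mem_edgeSpan_of_step hy).2
  · exact (mem_edgeSpan_of_step (hKF hs)).1

theorem reachable_edgeSpan_of_addEdge [DecidableEq E] {K : Subgraph G} {f : E} {F : Finset E}
    {x y : E × Bool} (hK : Connected G (K.addEdge f)) (hKF : K.edges ⊆ F) (hx : x.1 ∈ F)
    (hy : y.1 ∈ F) (hxy : stepStart G x = stepStart G y) (h : Joins G f x y) {u w : V}
    (hu : u ∈ (K.addEdge f).verts) (hw : w ∈ (K.addEdge f).verts) :
    Reachable G (edgeSpan G F) u w := by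
  refine (hK.2 u hu w hw).transport (fun e he => ?_) (mem_edgeSpan_of_addEdge hK hKF hx hy h hu)
  rcases Finset.mem_insert.1 he with rfl | he
  · exact h.reachable (K := edgeSpan G F) hx hy hxy
  · exact reachable_edge (K := edgeSpan G F) (hKF he)

end OneReductionUnion

/-- If the blockers `H₁, H₂` of two different 1-reductions at `v`
(adding `f₁` and `f₂`) satisfy `E(H₁ ∩ H₂) ≠ ∅` and `H₁ ∩ H₂` is balanced, then with
`H = H₁ ∪ H₂` we have `|E(H)| = 2|V(H)| − 3 + α_k^j(H + f₁ + f₂)`. -/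
theorem union_of_blockers_balanced_intersection
    {V E : Type} [DecidableEq V] [DecidableEq E] [Fintype V] [Fintype E]
    (k j : ℕ) (hk : 4 ≤ k) (hj2 : 2 ≤ j) (hjk : j ≤ k - 2)
    (G : GainedGraph V E (Multiplicative (ZMod k)))
    (G₀ : Subgraph G) (hG₀ : IsGainGraphOn G G₀)
    (htight : GainTightKJ G k j G₀)
    (v : V) (hv : v ∈ G₀.verts) (hvfree : v ∉ G.fixed)
    (hdeg : degree G G₀ v = 3) (hloop : ¬ HasLoopAt G G₀ v)
    (f₁ f₂ : E) (hf₁ : IsOneReduction G G₀ v f₁) (hf₂ : IsOneReduction G G₀ v f₂)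
    (hw₁ : IsGainGraphOn G (reduceAt G G₀ v f₁))
    (hw₂ : IsGainGraphOn G (reduceAt G G₀ v f₂))
    (hdiff : ¬ SameEdge G f₁ f₂)
    (H₁ H₂ : Subgraph G)
    (hb₁ : IsBlocker G k j G₀ v f₁ H₁) (hb₂ : IsBlocker G k j G₀ v f₂ H₂)
    (hE : ((H₁.inter H₂).edges).Nonempty)
    (hbal : Balanced G (H₁.inter H₂)) :
    (((H₁.union H₂).edges.card : ℤ)) =
      2 * (((H₁.union H₂).verts.card : ℤ)) - 3 +
        alpha G k j (((H₁.union H₂).addEdge f₁).addEdge f₂) := by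
  have : NeZero k := ⟨by omega⟩
  obtain ⟨hH₁, hv₁, ht₁, hh₁, -, hc₁, he₁⟩ := hb₁
  obtain ⟨hH₂, hv₂, ht₂, hh₂, -, hc₂, he₂⟩ := hb₂
  obtain ⟨x, y, z, hx, hD, hxv, hyv, hzv, hy, hz, hj₁, hj₂⟩ :=
    exists_joins_pair hdeg hloop hf₁ hf₂ hdiff
  have hM₁v := addEdge_verts ht₁ hh₁
  have hM₂v := addEdge_verts ht₂ hh₂
  set M₁ := H₁.addEdge f₁ with hM₁
  set M₂ := H₂.addEdge f₂ with hM₂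
  set H := H₁.union H₂ with hH
  set I := H₁.inter H₂ with hI
  set Y := (H.addEdge f₁).addEdge f₂ with hY
  have hYv : Y.verts = H.verts := by
    have hHf₁ : (H.addEdge f₁).verts = H.verts :=
      addEdge_verts (Finset.mem_union_left _ ht₁) (Finset.mem_union_left _ hh₁)
    rw [hY, addEdge_verts, hHf₁] <;> rw [hHf₁]
    · exact Finset.mem_union_right _ ht₂
    · exact Finset.mem_union_right _ hh₂
  have hvH : v ∉ H.verts := fun h => (Finset.mem_union.1 h).elim hv₁ hv₂
  set F := H.edges ∪ edgesAt G₀ v with hF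
  set X := edgeSpan G F with hX
  have hHF : H.edges ⊆ F := Finset.subset_union_left
  have hHF₁ : H₁.edges ⊆ F := Finset.subset_union_left.trans hHF
  have hHF₂ : H₂.edges ⊆ F := Finset.subset_union_right.trans hHF
  have hxF : x.1 ∈ F := Finset.mem_union_right _ hx
  have hyF : y.1 ∈ F := Finset.mem_union_right _ hy
  have hzF : z.1 ∈ F := Finset.mem_union_right _ hz
  have hXY : ∀ e ∈ X.edges, e ∈ H.edges ∨ e = x.1 ∨ e = y.1 ∨ e = z.1 := fun e he =>
    (Finset.mem_union.1 he).imp_right (hD e)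
  have hHY : H.edges ⊆ Y.edges := (Finset.subset_insert _ _).trans (Finset.subset_insert _ _)
  have hf₁Y : f₁ ∈ Y.edges := Finset.mem_insert_of_mem (Finset.mem_insert_self _ _)
  have hf₂Y : f₂ ∈ Y.edges := Finset.mem_insert_self _ _
  -- The graph `X` obtained from `H` by adding back the vertex `v`.
  have hend : ∀ {s : E × Bool}, stepStart G s = v → stepEnd G s ∈ H.verts →
      G.tail s.1 ∈ insert v H.verts ∧ G.head s.1 ∈ insert v H.verts := by
    rintro ⟨e, b⟩ h1 h2
    have h3 := Finset.mem_insert_of_mem (b := v) h2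
    have h4 : stepStart G (e, b) ∈ insert v H.verts := Finset.mem_insert.2 (Or.inl h1)
    cases b
    · exact ⟨h3, h4⟩
    · exact ⟨h4, h3⟩
  have hj₁e := hj₁.stepEnd_mem ht₁ hh₁
  have hj₂e := hj₂.stepEnd_mem ht₂ hh₂
  have hFend : ∀ e ∈ F, G.tail e ∈ insert v H.verts ∧ G.head e ∈ insert v H.verts := by
    intro e he
    rcases hXY e he with h | rfl | rfl | rfl
    · exact ⟨Finset.mem_insert_of_mem (H.tail_mem e h), Finset.mem_insert_of_mem (H.head_mem e h)⟩
    · exact hend hxv (Finset.mem_union_left _ hj₁e.1)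
    · exact hend hyv (Finset.mem_union_left _ hj₁e.2)
    · exact hend hzv (Finset.mem_union_right _ hj₂e.2)
  have hXv : X.verts = insert v H.verts := by
    apply Finset.Subset.antisymm
    · intro u hu
      rcases Finset.mem_union.1 hu with h | h <;> obtain ⟨e, he, rfl⟩ := Finset.mem_image.1 h
      · exact (hFend e he).1
      · exact (hFend e he).2
    · refine Finset.insert_subset (hxv ▸ (mem_edgeSpan_of_step hxF).1) (Finset.union_subset ?_ ?_)
      · exact fun u hu => mem_edgeSpan_of_addEdge hc₁ hHF₁ hxF hyF hj₁ (hM₁v.symm ▸ hu)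
      · exact fun u hu => mem_edgeSpan_of_addEdge hc₂ hHF₂ hxF hzF hj₂ (hM₂v.symm ▸ hu)
  have hXc : Connected G X := by
    have hvr : ∀ u ∈ X.verts, Reachable G X v u := by
      have hxr : Reachable G X v (stepEnd G x) := hxv ▸ reachable_step (K := X) hxF
      intro u hu
      rw [hXv, Finset.mem_insert] at hu
      rcases hu with rfl | hu
      · exact reachable_refl (hXv ▸ Finset.mem_insert_self u H.verts)
      rcases Finset.mem_union.1 hu with hu | hu
      · exact hxr.trans (reachable_edgeSpan_of_addEdge hc₁ hHF₁ hxF hyF (hxv.trans hyv.symm) hj₁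
          (hM₁v.symm ▸ hj₁e.1) (hM₁v.symm ▸ hu))
      · exact hxr.trans (reachable_edgeSpan_of_addEdge hc₂ hHF₂ hxF hzF (hxv.trans hzv.symm) hj₂
          (hM₂v.symm ▸ hj₂e.1) (hM₂v.symm ▸ hu))
    exact ⟨⟨v, hXv ▸ Finset.mem_insert_self v H.verts⟩,
      fun u hu w hw => (hvr u hu).symm.trans (hvr w hw)⟩
  have hXf : X.fixedVerts.card = Y.fixedVerts.card := by
    rw [Subgraph.fixedVerts, Subgraph.fixedVerts, hXv, hYv, Finset.insert_inter_of_notMem hvfree]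
  have hHG : H ≤ G₀ := ⟨Finset.union_subset hH₁.1 hH₂.1, Finset.union_subset hH₁.2 hH₂.2⟩
  have hXG : X ≤ G₀ := by
    refine ⟨?_, Finset.union_subset hHG.2 (Finset.filter_subset _ _)⟩
    rw [hXv]
    exact Finset.insert_subset hv hHG.1
  have hdisj : Disjoint H.edges (edgesAt G₀ v) := by
    rw [Finset.disjoint_left]
    intro e he heD
    rcases (Finset.mem_filter.1 heD).2 with h | h
    · exact hvH (h ▸ H.tail_mem e he)
    · exact hvH (h ▸ H.head_mem e he)
  have hXcard : (F.card : ℤ) = H.edges.card + 3 := by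
    rw [hF, Finset.card_union_of_disjoint hdisj, card_edgesAt hloop, hdeg]
    push_cast
    rfl
  have hXe : (F.card : ℤ) ≤ 2 * (X.verts.card : ℤ) - 3 + alpha G k j X := by
    rw [← fCount_of_connected ⟨_, hxF⟩ hXc]
    exact htight.1 X hXG ⟨_, hxF⟩
  rw [hXcard, hXv, Finset.card_insert_of_notMem hvH] at hXe
  have hEc : H.edges.card + I.edges.card = H₁.edges.card + H₂.edges.card :=
    Finset.card_union_add_card_inter _ _
  have hVc : H.verts.card + I.verts.card = H₁.verts.card + H₂.verts.card :=
    Finset.card_union_add_card_inter _ _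
  have hcount : alpha G k j M₁ + alpha G k j M₂ +
      (2 * (I.verts.card : ℤ) - 3 - I.edges.card) + 1 ≤ alpha G k j X := by
    push_cast at hXe
    omega
  suffices hα : alpha G k j Y =
      alpha G k j M₁ + alpha G k j M₂ + (2 * (I.verts.card : ℤ) - 3 - I.edges.card) by
    omega
  have hIG : I ≤ G₀ :=
    ⟨Finset.inter_subset_left.trans hH₁.1, Finset.inter_subset_left.trans hH₁.2⟩
  have hM₁Y : M₁ ≤ Y := by
    refine ⟨?_, Finset.insert_subset hf₁Y (Finset.subset_union_left.trans hHY)⟩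
    rw [hM₁v, hYv]
    exact Finset.subset_union_left
  have hM₂Y : M₂ ≤ Y := by
    refine ⟨?_, Finset.insert_subset hf₂Y (Finset.subset_union_right.trans hHY)⟩
    rw [hM₂v, hYv]
    exact Finset.subset_union_right
  have hIM₁ : I ≤ M₁ :=
    ⟨hM₁v.symm ▸ Finset.inter_subset_left,
      Finset.inter_subset_left.trans (Finset.subset_insert _ _)⟩
  have hIM₂ : I ≤ M₂ :=
    ⟨hM₂v.symm ▸ Finset.inter_subset_right,
      Finset.inter_subset_right.trans (Finset.subset_insert _ _)⟩
  have hVI : ∀ u ∈ M₁.verts, u ∈ M₂.verts → u ∈ I.verts := fun u h1 h2 =>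
    Finset.mem_inter.2 ⟨hM₁v ▸ h1, hM₂v ▸ h2⟩
  have hYe : ∀ e ∈ Y.edges, e ∈ H.edges ∨ e = f₁ ∨ e = f₂ := by
    intro e he
    rcases Finset.mem_insert.1 he with h | he
    · exact Or.inr (Or.inr h)
    · exact (Finset.mem_insert.1 he).symm.imp_right Or.inl
  have hYM : Y.edges ⊆ M₁.edges ∪ M₂.edges := by
    intro e he
    rw [Finset.mem_union]
    rcases hYe e he with h | rfl | rfl
    · exact (Finset.mem_union.1 h).imp Finset.mem_insert_of_mem Finset.mem_insert_of_mem
    · exact Or.inl (Finset.mem_insert_self _ _)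
    · exact Or.inr (Finset.mem_insert_self _ _)
  have hX1 : X.fixedVerts.card ≤ 1 := (card_fixedVerts_mono hXG).trans hG₀.fixed_card
  rcases Nat.le_one_iff_eq_zero_or_eq_one.1 hX1 with hX0 | hX1
  · have hXn := noFixed_iff.2 hX0
    have hYn := noFixed_iff.2 (hXf ▸ hX0)
    have hgg : gainGroup G X = gainGroup G Y :=
      gainGroup_eq_of_joins (fun e he => (hXY e he).imp_left fun h => hHY h)
        (fun e he => (hYe e he).imp_left fun h => hHF h) hf₁Y hf₂Y hxF hyF hzF hxv hyv hzv
        (hYv ▸ hvH) hXn hYn hj₁ hj₂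
    exact alpha_union_of_noFixed htight.1 hIG hbal hE hYM hM₁Y hM₂Y
      hIM₁ hIM₂ hVI hX0 hYn hgg hcount
  · exact alpha_union_of_fixed htight.1 hIG hbal hE
      (fun e he => hG₀.fixed_not_loop e (hIG.2 he)) hYM hM₁Y hM₂Y hIM₁ hIM₂ hVI hX1
      (hXf.symm.trans hX1) hcount

end GR
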